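/- arXiv:2602.24167 — 4 statements merged into one kernel-verified Lean document; each statement's English description precedes it below -/
import Mathlib

section
/- Let L be a finite-dimensional Lie algebra over a field K with two direct sum decompositions L = g_1 ⊕ … ⊕ g_r = h_1 ⊕ … ⊕ h_s into Lie ideals, each of which is directly indecomposable. Let π_i (resp. ρ_j) denote the projection onto g_i (resp. h_j) along the given decompositions. Then for every 1 ≤ i ≤ r there exists 1 ≤ j ≤ s such that: (1) the restrictions π_i|_{h_j} : h_j → g_i and ρ_j|_{g_i} : g_i → h_j are Lie algebra isomorphisms; (2) [g_i, g_i] = [h_j, h_j]; (3) h_j ⊆ g_i ⊕ Z(⊕_{k ≠ i} g_k) and g_i ⊆ h_j ⊕ Z(⊕_{k ≠ j} h_k). Moreover, if g_i is non-abelian, then condition (2) forces such j to be unique. -/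
/-- A Lie algebra is directly indecomposable if it is nonzero and admits no decomposition
as a direct sum of two nonzero ideals. -/
def LieDirectlyIndecomposable (K M : Type*) [Field K] [LieRing M] [LieAlgebra K M] : Prop :=
  Nontrivial M ∧
    ∀ I J : LieIdeal K M, I ⊓ J = ⊥ → I ⊔ J = ⊤ → I = ⊥ ∨ J = ⊥

/-- The linear map `p` restricts to a Lie algebra isomorphism from the ideal `A` onto the
ideal `B`. -/
def IsLieIsoOn {K L : Type*} [Field K] [LieRing L] [LieAlgebra K L]
    (p : L →ₗ[K] L) (A B : LieIdeal K L) : Prop :=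
  (∀ x ∈ A, p x ∈ B) ∧
  (∀ x ∈ A, ∀ y ∈ A, p ⁅x, y⁆ = ⁅p x, p y⁆) ∧
  Set.InjOn p (A : Set L) ∧
  (∀ y ∈ B, ∃ x ∈ A, p x = y)

/-- The set of elements of `⊕_{k ≠ i} f k` which centralize `⊕_{k ≠ i} f k`, i.e. the carrier
of `Z(⊕_{k ≠ i} f k)` viewed inside `L`. -/
def centerOfComplSup {K L : Type*} [Field K] [LieRing L] [LieAlgebra K L]
    {ι : Type*} (f : ι → LieIdeal K L) (i : ι) : Set L :=
  {z | z ∈ (⨆ k, ⨆ _ : k ≠ i, f k : LieIdeal K L) ∧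
    ∀ y ∈ (⨆ k, ⨆ _ : k ≠ i, f k : LieIdeal K L), ⁅z, y⁆ = 0}

/-- The endomorphisms of a Lie algebra commuting with the adjoint action. -/
def CommutesWithAd {K M : Type*} [Field K] [LieRing M] [LieAlgebra K M]
    (φ : Module.End K M) : Prop :=
  ∀ x y : M, φ ⁅x, y⁆ = ⁅x, φ y⁆

namespace CommutesWithAd

variable {K M : Type*} [Field K] [LieRing M] [LieAlgebra K M] {φ ψ : Module.End K M}

theorem mul (hφ : CommutesWithAd φ) (hψ : CommutesWithAd ψ) : CommutesWithAd (φ * ψ) := by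
  intro x y
  rw [Module.End.mul_apply, Module.End.mul_apply, hψ, hφ]

theorem pow (hφ : CommutesWithAd φ) (n : ℕ) : CommutesWithAd (φ ^ n) := by
  induction n with
  | zero => intro x y; simp
  | succ n ih => rw [pow_succ]; exact ih.mul hφ

theorem sum {ι : Type*} {s : Finset ι} {φ : ι → Module.End K M}
    (hφ : ∀ i ∈ s, CommutesWithAd (φ i)) : CommutesWithAd (∑ i ∈ s, φ i) := by
  intro x y
  rw [LinearMap.sum_apply, LinearMap.sum_apply, lie_sum]
  exact Finset.sum_congr rfl fun i hi => hφ i hi x y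

theorem units_inv {u : (Module.End K M)ˣ} (hu : CommutesWithAd (u : Module.End K M)) :
    CommutesWithAd (↑u⁻¹ : Module.End K M) := by
  intro x y
  have hl : ∀ z, (↑u⁻¹ : Module.End K M) ((u : Module.End K M) z) = z := fun z => by
    rw [← Module.End.mul_apply, Units.inv_mul, Module.End.one_apply]
  have hr : ∀ z, (u : Module.End K M) ((↑u⁻¹ : Module.End K M) z) = z := fun z => by
    rw [← Module.End.mul_apply, Units.mul_inv, Module.End.one_apply]
  conv_lhs => rw [← hr y, ← hu, hl]

/-- **Fitting's lemma** for directly indecomposable Lie algebras. -/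
theorem isNilpotent_or_isUnit [FiniteDimensional K M] (hM : LieDirectlyIndecomposable K M)
    (hφ : CommutesWithAd φ) : IsNilpotent φ ∨ IsUnit φ := by
  obtain ⟨n, hn⟩ := Filter.eventually_atTop.1 φ.eventually_isCompl_ker_pow_range_pow
  have hc := hn (n + 1) n.le_succ
  let I : LieIdeal K M :=
    { (φ ^ (n + 1)).ker with
      lie_mem := fun {x y} hy => by
        change (φ ^ (n + 1)) y = 0 at hy
        change (φ ^ (n + 1)) ⁅x, y⁆ = 0
        rw [hφ.pow, hy, lie_zero] }
  let J : LieIdeal K M :=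
    { (φ ^ (n + 1)).range with
      lie_mem := fun {x y} hy => by
        obtain ⟨z, rfl⟩ := hy
        exact ⟨⁅x, z⁆, hφ.pow _ x z⟩ }
  have hI : LieSubmodule.toSubmodule I = (φ ^ (n + 1)).ker := rfl
  have hJ : LieSubmodule.toSubmodule J = (φ ^ (n + 1)).range := rfl
  have hinf : I ⊓ J = ⊥ := by
    rw [← LieSubmodule.toSubmodule_inj, LieSubmodule.inf_toSubmodule, hI, hJ, hc.inf_eq_bot,
      LieSubmodule.bot_toSubmodule]
  have hsup : I ⊔ J = ⊤ := by
    rw [← LieSubmodule.toSubmodule_inj, LieSubmodule.sup_toSubmodule, hI, hJ, hc.sup_eq_top,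
      LieSubmodule.top_toSubmodule]
  rcases hM.2 I J hinf hsup with h | h
  · right
    rw [h, LieSubmodule.bot_toSubmodule] at hI
    exact (isUnit_pow_iff n.succ_ne_zero).1 ((LinearMap.isUnit_iff_ker_eq_bot _).2 hI.symm)
  · left
    rw [h, LieSubmodule.bot_toSubmodule] at hJ
    exact ⟨n + 1, LinearMap.range_eq_bot.1 hJ.symm⟩

theorem exists_isUnit_of_isUnit_sum [FiniteDimensional K M]
    (hM : LieDirectlyIndecomposable K M) {ι : Type*} (s : Finset ι) {φ : ι → Module.End K M}
    (hφ : ∀ i ∈ s, CommutesWithAd (φ i)) (hs : IsUnit (∑ i ∈ s, φ i)) :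
    ∃ i ∈ s, IsUnit (φ i) := by
  classical
  have := hM.1
  induction s using Finset.induction_on with
  | empty => simp at hs
  | insert a s ha ih =>
    have hφa : CommutesWithAd (φ a) := hφ a (Finset.mem_insert_self a s)
    have hφs : ∀ i ∈ s, CommutesWithAd (φ i) := fun i hi => hφ i (Finset.mem_insert_of_mem hi)
    obtain ⟨u, hu⟩ := hs
    have huc : CommutesWithAd (↑u⁻¹ : Module.End K M) :=
      units_inv (by rw [hu]; exact sum hφ)
    rw [Finset.sum_insert ha] at hu
    rcases (huc.mul hφa).isNilpotent_or_isUnit hM with hn | hn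
    · have hsum : (↑u⁻¹ : Module.End K M) * ∑ i ∈ s, φ i = 1 - ↑u⁻¹ * φ a := by
        rw [eq_sub_iff_add_eq', ← mul_add, ← hu, Units.inv_mul]
      have hunit := hn.isUnit_one_sub
      rw [← hsum, Units.isUnit_units_mul] at hunit
      obtain ⟨i, hi, hiu⟩ := ih hφs hunit
      exact ⟨i, Finset.mem_insert_of_mem hi, hiu⟩
    · rw [Units.isUnit_units_mul] at hn
      exact ⟨a, Finset.mem_insert_self a s, hn⟩

end CommutesWithAd

/-- `p` is the family of projections attached to a decomposition of `L` into the ideals `f i`. -/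
structure IsProjectionFamily {K L : Type*} [Field K] [LieRing L] [LieAlgebra K L] {ι : Type*}
    (f : ι → LieIdeal K L) (p : ι → (L →ₗ[K] L)) : Prop where
  iSup_eq_top : (⨆ i, f i) = ⊤
  mem : ∀ i x, p i x ∈ f i
  apply_of_mem : ∀ i, ∀ x ∈ f i, p i x = x
  apply_of_ne : ∀ i k, k ≠ i → ∀ x ∈ f k, p i x = 0

namespace IsProjectionFamily

variable {K L : Type*} [Field K] [LieRing L] [LieAlgebra K L] {ι κ : Type*}
  {f : ι → LieIdeal K L} {p : ι → (L →ₗ[K] L)} {g : κ → LieIdeal K L} {q : κ → (L →ₗ[K] L)}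

theorem induction (hp : IsProjectionFamily f p) {P : L → Prop} (hmem : ∀ i, ∀ x ∈ f i, P x)
    (hzero : P 0) (hadd : ∀ x y, P x → P y → P (x + y)) (x : L) : P x :=
  LieSubmodule.iSup_induction f (motive := P) (x := x)
    (by rw [hp.iSup_eq_top]; exact LieSubmodule.mem_top x) hmem hzero hadd

theorem sum_apply [Fintype ι] (hp : IsProjectionFamily f p) (x : L) : ∑ i, p i x = x := by
  refine hp.induction (P := fun x => ∑ i, p i x = x) (fun i x hx => ?_) (by simp)
    (fun x y hx hy => by simp only [map_add, Finset.sum_add_distrib, hx, hy]) x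
  rw [Finset.sum_eq_single i (fun k _ hk => hp.apply_of_ne k i hk.symm x hx) (by simp),
    hp.apply_of_mem i x hx]

theorem map_lie (hp : IsProjectionFamily f p) (i : ι) (x y : L) : p i ⁅x, y⁆ = ⁅x, p i y⁆ := by
  refine hp.induction (P := fun y => p i ⁅x, y⁆ = ⁅x, p i y⁆) (fun k y hy => ?_) (by simp)
    (fun y z hy hz => by simp only [lie_add, map_add, hy, hz]) y
  have hxy : ⁅x, y⁆ ∈ f k := (f k).lie_mem hy
  rcases eq_or_ne k i with rfl | hk
  · rw [hp.apply_of_mem k _ hxy, hp.apply_of_mem k y hy]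
  · rw [hp.apply_of_ne i k hk _ hxy, hp.apply_of_ne i k hk y hy, lie_zero]

theorem map_lie_lie (hp : IsProjectionFamily f p) (i : ι) (x y : L) :
    p i ⁅x, y⁆ = ⁅p i x, p i y⁆ := by
  rw [← hp.map_lie, ← lie_skew (p i x), map_neg, hp.map_lie i y (p i x),
    hp.apply_of_mem i _ (hp.mem i x), ← hp.map_lie i y x, ← map_neg, lie_skew]

theorem sub_apply_mem (hp : IsProjectionFamily f p) (i : ι) (x : L) :
    x - p i x ∈ (⨆ k, ⨆ _ : k ≠ i, f k : LieIdeal K L) := by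
  refine hp.induction (P := fun x => x - p i x ∈ (⨆ k, ⨆ _ : k ≠ i, f k : LieIdeal K L))
    (fun k x hx => ?_) (by simp) (fun x y hx hy => ?_) x
  · rcases eq_or_ne k i with rfl | hk
    · rw [hp.apply_of_mem k x hx, sub_self]
      exact zero_mem _
    · rw [hp.apply_of_ne i k hk x hx, sub_zero]
      exact le_iSup₂ (f := fun k (_ : k ≠ i) => f k) k hk hx
  · rw [map_add, add_sub_add_comm]
    exact add_mem hx hy

theorem apply_eq_zero_of_mem_compl (hp : IsProjectionFamily f p) {i : ι} {y : L}
    (hy : y ∈ (⨆ k, ⨆ _ : k ≠ i, f k : LieIdeal K L)) : p i y = 0 := by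
  rw [← LieSubmodule.mem_toSubmodule] at hy
  simp only [LieSubmodule.iSup_toSubmodule] at hy
  have hle : (⨆ k, ⨆ _ : k ≠ i, (f k : Submodule K L)) ≤ (p i).ker :=
    iSup₂_le fun k hk x hx => hp.apply_of_ne i k hk x hx
  exact hle hy

theorem isLieIsoOn (hp : IsProjectionFamily f p) {i : ι} {A : LieIdeal K L}
    (hinj : Set.InjOn (p i) (A : Set L)) (hsurj : ∀ y ∈ f i, ∃ x ∈ A, p i x = y) :
    IsLieIsoOn (p i) A (f i) :=
  ⟨fun x _ => hp.mem i x, fun x _ y _ => hp.map_lie_lie i x y, hinj, hsurj⟩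

theorem exists_add_mem_center (hp : IsProjectionFamily f p) {i : ι} {A : LieIdeal K L}
    (hinj : Set.InjOn (p i) (A : Set L)) {x : L} (hx : x ∈ A) :
    ∃ a ∈ f i, ∃ z ∈ centerOfComplSup f i, x = a + z := by
  refine ⟨p i x, hp.mem i x, x - p i x, ⟨hp.sub_apply_mem i x, fun y hy => ?_⟩, by abel⟩
  have hy0 : p i y = 0 := hp.apply_eq_zero_of_mem_compl hy
  have h1 : ⁅x, y⁆ = 0 := by
    refine hinj (lie_mem_left K L A x y hx) (zero_mem A) ?_
    rw [hp.map_lie, hy0, lie_zero, map_zero]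
  have h2 : ⁅p i x, y⁆ = 0 := by
    rw [← lie_skew, ← hp.map_lie, ← lie_skew, map_neg, neg_neg, hp.map_lie, hy0, lie_zero]
  rw [sub_lie, h1, h2, sub_zero]

theorem lie_self_eq_lie (hp : IsProjectionFamily f p) {i : ι} {A : LieIdeal K L}
    (hsurj : ∀ y ∈ f i, ∃ x ∈ A, p i x = y) : ⁅f i, f i⁆ = ⁅f i, A⁆ := by
  have key : ∀ x ∈ f i, ∀ y, ⁅x, p i y⁆ = ⁅x, y⁆ := fun x hx y => by
    rw [← hp.map_lie, hp.apply_of_mem i _ (lie_mem_left K L (f i) x y hx)]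
  apply le_antisymm
  · rw [LieSubmodule.lieIdeal_oper_eq_span, LieSubmodule.lieSpan_le]
    rintro _ ⟨x, y, rfl⟩
    obtain ⟨z, hz, hzy⟩ := hsurj y y.2
    change ⁅(x : L), (y : L)⁆ ∈ ⁅f i, A⁆
    rw [← hzy, key x x.2]
    exact LieSubmodule.lie_mem_lie x.2 hz
  · rw [LieSubmodule.lieIdeal_oper_eq_span, LieSubmodule.lieSpan_le]
    rintro _ ⟨x, y, rfl⟩
    change ⁅(x : L), (y : L)⁆ ∈ ⁅f i, f i⁆
    rw [← key x x.2]
    exact LieSubmodule.lie_mem_lie x.2 (hp.mem i y)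

/-- The restriction of the projection onto `f i` to an ideal `A`. -/
def restrict (hp : IsProjectionFamily f p) (i : ι) (A : LieIdeal K L) : A →ₗ[K] f i :=
  (p i).restrict (p := (A : Submodule K L)) (q := (f i : Submodule K L)) fun x _ => hp.mem i x

theorem commutesWithAd (hp : IsProjectionFamily f p) (hq : IsProjectionFamily g q)
    (i : ι) (j : κ) :
    CommutesWithAd (K := K) (M := f i) (hp.restrict i (g j) ∘ₗ hq.restrict j (f i)) := by
  intro x y
  apply Subtype.ext
  change p i (q j ⁅(x : L), (y : L)⁆) = ⁅(x : L), p i (q j y)⁆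
  rw [hq.map_lie, hp.map_lie]

theorem exists_bijective [FiniteDimensional K L] [Fintype κ] (hp : IsProjectionFamily f p)
    (hq : IsProjectionFamily g q) (i : ι) (hi : LieDirectlyIndecomposable K (f i))
    (hg : ∀ j, LieDirectlyIndecomposable K (g j)) :
    ∃ j, Function.Bijective (hp.restrict i (g j)) ∧
      Function.Bijective (hq.restrict j (f i)) := by
  have := hi.1
  have hsum : ∑ j, (hp.restrict i (g j) ∘ₗ hq.restrict j (f i) : Module.End K (f i)) = 1 := by
    ext x
    rw [LinearMap.sum_apply, Module.End.one_apply]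
    change (LieSubmodule.incl (f i)) (∑ j, hp.restrict i (g j) (hq.restrict j (f i) x)) = x
    rw [map_sum]
    change ∑ j, p i (q j x) = x
    rw [← map_sum, hq.sum_apply, hp.apply_of_mem i x x.2]
  obtain ⟨j, -, hj⟩ := CommutesWithAd.exists_isUnit_of_isUnit_sum hi Finset.univ
    (fun j _ => hp.commutesWithAd hq i j) (hsum ▸ isUnit_one)
  refine ⟨j, ?_⟩
  set A := hp.restrict i (g j)
  set B := hq.restrict j (f i)
  have hBA : IsUnit (B ∘ₗ A : Module.End K (g j)) := by
    refine ((hq.commutesWithAd hp j i).isNilpotent_or_isUnit (hg j)).resolve_left ?_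
    rintro ⟨n, hn⟩
    have hpow : ∀ m : ℕ, (A ∘ₗ B : Module.End K (f i)) ^ (m + 1)
        = A ∘ₗ ((B ∘ₗ A : Module.End K (g j)) ^ m) ∘ₗ B := by
      intro m
      induction m with
      | zero => ext x; simp
      | succ m ih => rw [pow_succ, ih, pow_succ]; rfl
    have h0 : (A ∘ₗ B : Module.End K (f i)) ^ (n + 1) = 0 := by
      rw [hpow n]
      rw [show (B ∘ₗ A : Module.End K (g j)) ^ n = 0 from hn, LinearMap.zero_comp,
        LinearMap.comp_zero]
    exact not_isUnit_zero (h0 ▸ hj.pow (n + 1))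
  have hAB' : Function.Bijective (A ∘ B) := (Module.End.isUnit_iff _).1 hj
  have hBA' : Function.Bijective (B ∘ A) := (Module.End.isUnit_iff _).1 hBA
  exact ⟨⟨hBA'.1.of_comp, hAB'.2.of_comp⟩, ⟨hAB'.1.of_comp, hBA'.2.of_comp⟩⟩

theorem injOn_of_injective_restrict (hp : IsProjectionFamily f p) {i : ι} {A : LieIdeal K L}
    (h : Function.Injective (hp.restrict i A)) : Set.InjOn (p i) (A : Set L) :=
  fun x hx y hy hxy => congrArg Subtype.val (@h ⟨x, hx⟩ ⟨y, hy⟩ (Subtype.ext hxy))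

theorem exists_of_surjective_restrict (hp : IsProjectionFamily f p) {i : ι} {A : LieIdeal K L}
    (h : Function.Surjective (hp.restrict i A)) : ∀ y ∈ f i, ∃ x ∈ A, p i x = y := by
  intro y hy
  obtain ⟨x, hx⟩ := h ⟨y, hy⟩
  exact ⟨x, x.2, congrArg Subtype.val hx⟩

end IsProjectionFamily

theorem LieIdeal.isLieAbelian_of_lie_self_eq_bot {K L : Type*} [Field K] [LieRing L]
    [LieAlgebra K L] {I : LieIdeal K L} (h : ⁅I, I⁆ = ⊥) : IsLieAbelian I := by
  refine ⟨fun x y => Subtype.ext ?_⟩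
  have hxy : ⁅(x : L), (y : L)⁆ ∈ ⁅I, I⁆ := LieSubmodule.lie_mem_lie x.2 y.2
  rw [h, LieSubmodule.mem_bot] at hxy
  exact hxy

/-- **main lemma towards Krull–Schmidt.** Given two direct sum decompositions
`L = g₁ ⊕ ⋯ ⊕ g_r = h₁ ⊕ ⋯ ⊕ h_s` into directly indecomposable Lie ideals, with projections
`π i` and `ρ j`, for each `i` there is a `j` such that `π i` restricts to an isomorphism
`h j ≃ g i` and `ρ j` restricts to an isomorphism `g i ≃ h j`, `[g i, g i] = [h j, h j]`,
`h j ⊆ g i ⊕ Z(⊕_{k ≠ i} g k)` and `g i ⊆ h j ⊕ Z(⊕_{k ≠ j} h k)`.  If moreover `g i` is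
non-abelian, the condition `[g i, g i] = [h j, h j]` forces `j` to be unique. -/
theorem stmt4 {K L : Type*} [Field K] [LieRing L] [LieAlgebra K L]
    [FiniteDimensional K L] {r s : ℕ}
    (g : Fin r → LieIdeal K L) (h : Fin s → LieIdeal K L)
    (hgsup : (⨆ i, g i) = ⊤)
    (hgdisj : ∀ i, g i ⊓ (⨆ k, ⨆ _ : k ≠ i, g k) = ⊥)
    (hhsup : (⨆ j, h j) = ⊤)
    (hhdisj : ∀ j, h j ⊓ (⨆ k, ⨆ _ : k ≠ j, h k) = ⊥)
    (hgind : ∀ i, LieDirectlyIndecomposable K (g i))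
    (hhind : ∀ j, LieDirectlyIndecomposable K (h j))
    (π : Fin r → (L →ₗ[K] L)) (ρ : Fin s → (L →ₗ[K] L))
    (hπmem : ∀ i x, π i x ∈ g i)
    (hπid : ∀ i, ∀ x ∈ g i, π i x = x)
    (hπzero : ∀ i k, k ≠ i → ∀ x ∈ g k, π i x = 0)
    (hρmem : ∀ j x, ρ j x ∈ h j)
    (hρid : ∀ j, ∀ x ∈ h j, ρ j x = x)
    (hρzero : ∀ j k, k ≠ j → ∀ x ∈ h k, ρ j x = 0) :
    ∀ i : Fin r, ∃ j : Fin s,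
      (IsLieIsoOn (π i) (h j) (g i) ∧ IsLieIsoOn (ρ j) (g i) (h j)) ∧
      ⁅g i, g i⁆ = ⁅h j, h j⁆ ∧
      ((∀ x ∈ h j, ∃ a ∈ g i, ∃ z ∈ centerOfComplSup g i, x = a + z) ∧
        (∀ x ∈ g i, ∃ a ∈ h j, ∃ z ∈ centerOfComplSup h j, x = a + z)) ∧
      (¬ IsLieAbelian (g i) →
        ∀ j₁ j₂ : Fin s, ⁅g i, g i⁆ = ⁅h j₁, h j₁⁆ → ⁅g i, g i⁆ = ⁅h j₂, h j₂⁆ → j₁ = j₂) := by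
  intro i
  have hp : IsProjectionFamily g π := ⟨hgsup, hπmem, hπid, hπzero⟩
  have hq : IsProjectionFamily h ρ := ⟨hhsup, hρmem, hρid, hρzero⟩
  obtain ⟨j, hA, hB⟩ := hp.exists_bijective hq i (hgind i) hhind
  have hAinj := hp.injOn_of_injective_restrict hA.1
  have hBinj := hq.injOn_of_injective_restrict hB.1
  have hAsurj := hp.exists_of_surjective_restrict hA.2
  have hBsurj := hq.exists_of_surjective_restrict hB.2
  refine ⟨j, ⟨hp.isLieIsoOn hAinj hAsurj, hq.isLieIsoOn hBinj hBsurj⟩, ?_,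
    ⟨fun x hx => hp.exists_add_mem_center hAinj hx,
      fun x hx => hq.exists_add_mem_center hBinj hx⟩, ?_⟩
  · rw [hp.lie_self_eq_lie hAsurj, hq.lie_self_eq_lie hBsurj, LieSubmodule.lie_comm]
  · intro hab j₁ j₂ h₁ h₂
    by_contra hne
    apply hab
    apply LieIdeal.isLieAbelian_of_lie_self_eq_bot
    rw [eq_bot_iff, ← hhdisj j₁]
    refine le_inf (h₁ ▸ LieSubmodule.lie_le_right _ _) ?_
    refine (h₂ ▸ LieSubmodule.lie_le_right _ _ : ⁅g i, g i⁆ ≤ h j₂).trans ?_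
    exact le_iSup₂ (f := fun k (_ : k ≠ j₁) => h k) j₂ (Ne.symm hne)
end

section
/- (Krull–Schmidt theorem for Lie algebras.) Let L be a finite-dimensional Lie algebra over a field K with two direct sum decompositions L = g_1 ⊕ … ⊕ g_r = h_1 ⊕ … ⊕ h_s into Lie ideals, each of which is directly indecomposable. Let π_i denote the projection onto g_i along the first decomposition. Then r = s, and there exists a permutation σ of {1,…,r} such that whenever j = σ(i): (1) the projection π_i|_{h_j} : h_j → g_i is a Lie algebra isomorphism; (2) [g_i, g_i] = [h_j, h_j]; (3) h_j ⊆ g_i ⊕ Z(⊕_{k ≠ i} g_k). -/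
section KrullSchmidt

variable {A V M N : Type*} [Ring A] [AddCommGroup V] [Module A V]
  [AddCommGroup M] [Module A M] [AddCommGroup N] [Module A N]

/-- A module is indecomposable if it is nonzero and is not a direct sum of two nonzero
submodules. -/
def ModuleIndecomposable (A M : Type*) [Ring A] [AddCommGroup M] [Module A M] : Prop :=
  Nontrivial M ∧ ∀ I J : Submodule A M, IsCompl I J → I = ⊥ ∨ J = ⊥

/-- Fitting's lemma: an endomorphism of an indecomposable module of finite length is invertible
or nilpotent. -/
theorem ModuleIndecomposable.isUnit_or_isNilpotent [IsNoetherian A M] [IsArtinian A M]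
    (hM : ModuleIndecomposable A M) (f : Module.End A M) : IsUnit f ∨ IsNilpotent f := by
  obtain ⟨n, hn⟩ := Filter.eventually_atTop.mp
    (LinearMap.eventually_isCompl_ker_pow_range_pow (R := A) f)
  have hc := hn (n + 1) (Nat.le_succ n)
  rcases hM.2 _ _ hc with h | h
  · left
    have hr : LinearMap.range (f ^ (n + 1)) = ⊤ := by simpa [h] using hc.sup_eq_top
    have hu : IsUnit (f ^ (n + 1)) :=
      (Module.End.isUnit_iff _).2 ⟨LinearMap.ker_eq_bot.1 h, LinearMap.range_eq_top.1 hr⟩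
    exact (isUnit_pow_iff (Nat.succ_ne_zero n)).1 hu
  · right
    exact ⟨n + 1, LinearMap.range_eq_bot.1 h⟩

theorem ModuleIndecomposable.isUnit_or_isUnit_of_add [IsNoetherian A M] [IsArtinian A M]
    (hM : ModuleIndecomposable A M) {f g : Module.End A M} (h : IsUnit (f + g)) :
    IsUnit f ∨ IsUnit g := by
  obtain ⟨u, hu⟩ := h
  have key : ↑u⁻¹ * f + ↑u⁻¹ * g = 1 := by rw [← mul_add, ← hu, Units.inv_mul]
  rcases hM.isUnit_or_isNilpotent (↑u⁻¹ * f) with hf | hf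
  · left
    exact (Units.isUnit_units_mul u⁻¹ f).1 hf
  · right
    refine (Units.isUnit_units_mul u⁻¹ g).1 ?_
    rw [← eq_sub_iff_add_eq'] at key
    rw [key]
    exact hf.isUnit_one_sub

theorem ModuleIndecomposable.exists_isUnit_of_sum [IsNoetherian A M] [IsArtinian A M]
    (hM : ModuleIndecomposable A M) {κ : Type*} (T : Finset κ) (f : κ → Module.End A M)
    (h : IsUnit (∑ j ∈ T, f j)) : ∃ j ∈ T, IsUnit (f j) := by
  classical
  induction T using Finset.induction_on with
  | empty =>
    have := hM.1
    simp at h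
  | insert a T ha ih =>
    rw [Finset.sum_insert ha] at h
    rcases hM.isUnit_or_isUnit_of_add h with h | h
    · exact ⟨a, Finset.mem_insert_self _ _, h⟩
    · obtain ⟨j, hj, hu⟩ := ih h
      exact ⟨j, Finset.mem_insert_of_mem hj, hu⟩

/-- If a composition of linear maps through an indecomposable module is bijective, then both
factors are bijective. -/
theorem ModuleIndecomposable.bijective_of_comp [Nontrivial M] (hN : ModuleIndecomposable A N)
    (a : M →ₗ[A] N) (b : N →ₗ[A] M) (h : Function.Bijective (b ∘ₗ a)) :
    Function.Bijective a ∧ Function.Bijective b := by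
  rw [LinearMap.coe_comp] at h
  have ha : Function.Injective a := h.1.of_comp
  have hb : Function.Surjective b := h.2.of_comp
  have hc : IsCompl (LinearMap.range a) (LinearMap.ker b) := by
    constructor
    · rw [Submodule.disjoint_def]
      rintro _ ⟨x, rfl⟩ hx
      have : x = 0 := h.1 (by simpa using hx)
      simp [this]
    · rw [codisjoint_iff, eq_top_iff]
      intro y _
      obtain ⟨x, hx⟩ := h.2 (b y)
      refine Submodule.mem_sup.2 ⟨a x, ⟨x, rfl⟩, y - a x, ?_, by abel⟩
      simp only [Function.comp_apply] at hx
      simp [hx]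
  rcases hN.2 _ _ hc with h0 | h0
  · exfalso
    obtain ⟨x, hx⟩ := exists_ne (0 : M)
    have : a = 0 := LinearMap.range_eq_bot.1 h0
    exact hx (ha (by simp [this]))
  · have hr : LinearMap.range a = ⊤ := by simpa [h0] using hc.sup_eq_top
    exact ⟨⟨ha, LinearMap.range_eq_top.1 hr⟩, LinearMap.ker_eq_bot.1 h0, hb⟩

/-- Exchange step: if `V = P ⊕ ⨁ j ∈ T, h j` and `p` is a projection onto the indecomposable
submodule `G` vanishing on `P`, then for some `j ∈ T` the map `p` identifies `h j` with `G`, and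
`h j` may be replaced by `G` in the decomposition. -/
theorem exists_bijOn_isCompl_exchange [IsNoetherian A V] [IsArtinian A V] {κ : Type*}
    [DecidableEq κ] {G P : Submodule A V} {h q : κ → Submodule A V} {T : Finset κ}
    (hG : ModuleIndecomposable A G) (hh : ∀ j, ModuleIndecomposable A (h j))
    (hq : ∀ j, IsCompl (h j) (q j)) (hhq : ∀ j k, k ≠ j → h k ≤ q j)
    (hPT : IsCompl P (⨆ j ∈ T, h j))
    (p : V →ₗ[A] V) (hp : ∀ x, p x ∈ G) (hpG : ∀ x ∈ G, p x = x) (hpP : ∀ x ∈ P, p x = 0) :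
    ∃ j ∈ T, Set.BijOn p (h j) G ∧ IsCompl (G ⊔ P) (⨆ k ∈ T.erase j, h k) := by
  have hsum : ∀ x ∈ ⨆ j ∈ T, h j, ∑ j ∈ T, (h j).projection (q j) (hq j) x = x := by
    intro x hx
    have hle : (⨆ j ∈ T, h j) ≤
        LinearMap.eqLocus (∑ j ∈ T, (h j).projection (q j) (hq j)) LinearMap.id := by
      refine iSup₂_le fun j hj y hy => ?_
      rw [LinearMap.mem_eqLocus, LinearMap.sum_apply, Finset.sum_eq_single_of_mem j hj]
      · exact Submodule.projection_apply_left (hq j) ⟨y, hy⟩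
      · intro k _ hkj
        exact (Submodule.projection_apply_eq_zero_iff (hq k)).2 (hhq k j hkj.symm hy)
    simpa using hle hx
  set u : V →ₗ[A] V := (⨆ j ∈ T, h j).projection P hPT.symm
  have hu_mem : ∀ x, u x ∈ ⨆ j ∈ T, h j := Submodule.projection_apply_mem hPT.symm
  have hu_sub : ∀ x, x - u x ∈ P := Submodule.sub_projection_mem hPT.symm
  have hu_zero : ∀ x ∈ P, u x = 0 :=
    fun x hx => (Submodule.projection_apply_eq_zero_iff hPT.symm).2 hx
  have hu_id : ∀ x ∈ ⨆ j ∈ T, h j, u x = x :=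
    fun x hx => Submodule.projection_apply_left hPT.symm ⟨x, hx⟩
  have hQ : ∀ j x, (h j).projection (q j) (hq j) x ∈ h j :=
    fun j => Submodule.projection_apply_mem (hq j)
  let a : ∀ j, G →ₗ[A] h j := fun j =>
    (((h j).projection (q j) (hq j) ∘ₗ u).codRestrict (h j) fun x => hQ j _) ∘ₗ G.subtype
  let b : ∀ j, h j →ₗ[A] G := fun j => (p.codRestrict G hp) ∘ₗ (h j).subtype
  have hone : ∑ j ∈ T, (b j ∘ₗ a j : Module.End A G) = 1 := by
    ext x
    have h1 : p (u x) = x := by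
      have := hpP _ (hu_sub x)
      rw [map_sub, sub_eq_zero] at this
      rw [← this, hpG _ x.2]
    have h2 : ((∑ j ∈ T, (b j ∘ₗ a j : Module.End A G)) x : V) =
        p (∑ j ∈ T, (h j).projection (q j) (hq j) (u x)) := by
      simp [LinearMap.sum_apply, a, b]
    rw [h2, hsum _ (hu_mem x), h1]
    rfl
  obtain ⟨j, hj, hjU⟩ := hG.exists_isUnit_of_sum T (fun j => b j ∘ₗ a j)
    (hone ▸ isUnit_one)
  have := hG.1
  obtain ⟨ha, hb⟩ := (hh j).bijective_of_comp (a j) (b j) ((Module.End.isUnit_iff _).1 hjU)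
  have hTj : (⨆ k ∈ T, h k) = h j ⊔ ⨆ k ∈ T.erase j, h k := by
    conv_lhs => rw [← Finset.insert_erase hj]
    rw [Finset.iSup_insert]
  refine ⟨j, hj, ⟨fun x _ => hp x, ?_, ?_⟩, ?_, ?_⟩
  · intro x hx y hy hxy
    have : (⟨x, hx⟩ : h j) = ⟨y, hy⟩ := hb.1 (Subtype.ext hxy)
    exact congrArg Subtype.val this
  · intro y hy
    obtain ⟨x, hx⟩ := hb.2 ⟨y, hy⟩
    exact ⟨x, x.2, congrArg Subtype.val hx⟩
  · rw [Submodule.disjoint_def]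
    intro x hx hx'
    have hxT : x ∈ ⨆ k ∈ T, h k := hTj ▸ Submodule.mem_sup_right hx'
    have hxq : (h j).projection (q j) (hq j) x = 0 := by
      refine (Submodule.projection_apply_eq_zero_iff (hq j)).2 ?_
      exact (iSup₂_le fun k hk => hhq j k (Finset.ne_of_mem_erase hk) :
        (⨆ k ∈ T.erase j, h k) ≤ q j) hx'
    obtain ⟨y, hy, z, hz, rfl⟩ := Submodule.mem_sup.1 hx
    have hy0 : a j ⟨y, hy⟩ = 0 := by
      apply Subtype.ext
      change (h j).projection (q j) (hq j) (u y) = 0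
      rw [← hxq, ← hu_id _ hxT, map_add u, hu_zero z hz, add_zero]
    have : (⟨y, hy⟩ : G) = 0 := ha.1 (by rw [hy0, map_zero])
    have hy' : y = 0 := congrArg Subtype.val this
    subst hy'
    rw [zero_add] at hxT ⊢
    exact Submodule.disjoint_def.1 hPT.disjoint z hz hxT
  · rw [codisjoint_iff, eq_top_iff, ← hPT.sup_eq_top, hTj]
    refine sup_le (le_sup_of_le_left le_sup_right) (sup_le ?_ le_sup_right)
    intro x hx
    obtain ⟨y, hy⟩ := ha.2 ⟨x, hx⟩
    have hy : (h j).projection (q j) (hq j) (u y) = x := congrArg Subtype.val hy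
    have hs := hsum _ (hu_mem (y : V))
    rw [← Finset.add_sum_erase _ _ hj, hy] at hs
    have hx_eq : x = ((y : V) - (y - u y)) -
        ∑ k ∈ T.erase j, (h k).projection (q k) (hq k) (u y) := by
      rw [sub_sub_cancel]
      exact eq_sub_of_add_eq hs
    rw [hx_eq]
    refine sub_mem (Submodule.mem_sup_left (sub_mem (Submodule.mem_sup_left y.2)
      (Submodule.mem_sup_right (hu_sub _)))) (Submodule.mem_sup_right ?_)
    exact Submodule.sum_mem _ fun k hk => Submodule.mem_iSup_of_mem k
      (Submodule.mem_iSup_of_mem hk (hQ k _))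

/-- The Krull–Schmidt theorem for modules of finite length, with the isomorphisms realised by the
projections along the first decomposition. -/
theorem exists_equiv_bijOn_projection [IsNoetherian A V] [IsArtinian A V] {ι κ : Type*}
    [Finite ι] [Finite κ] {g : ι → Submodule A V} {h : κ → Submodule A V}
    (hg : ∀ i, ModuleIndecomposable A (g i)) (hh : ∀ j, ModuleIndecomposable A (h j))
    (hgsup : ⨆ i, g i = ⊤) (hhind : iSupIndep h) (hhsup : ⨆ j, h j = ⊤)
    (p : ι → V →ₗ[A] V) (hp : ∀ i x, p i x ∈ g i) (hpid : ∀ i, ∀ x ∈ g i, p i x = x)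
    (hpzero : ∀ i k, k ≠ i → ∀ x ∈ g k, p i x = 0) :
    ∃ σ : ι ≃ κ, ∀ i, Set.BijOn (p i) (h (σ i)) (g i) := by
  classical
  have := Fintype.ofFinite ι
  have := Fintype.ofFinite κ
  have hq : ∀ j, IsCompl (h j) (⨆ k, ⨆ _ : k ≠ j, h k) := fun j => by
    refine ⟨hhind j, ?_⟩
    rw [codisjoint_iff, eq_top_iff, ← hhsup]
    refine iSup_le fun k => ?_
    by_cases hk : k = j
    · exact hk ▸ le_sup_left
    · exact le_sup_of_le_right (le_iSup₂_of_le k hk le_rfl)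
  have main : ∀ D : Finset ι, ∃ σ : ι → κ, Set.InjOn σ D ∧
      (∀ i ∈ D, Set.BijOn (p i) (h (σ i)) (g i)) ∧
      IsCompl (⨆ i ∈ D, g i) (⨆ j ∈ (D.image σ)ᶜ, h j) := by
    intro D
    induction D using Finset.induction_on with
    | empty =>
      rcases isEmpty_or_nonempty ι with hι | ⟨⟨i⟩⟩
      · have htop : (⊥ : Submodule A V) = ⊤ := by rw [← hgsup, iSup_of_empty]
        have hκ : IsEmpty κ := ⟨fun j => by
          obtain ⟨x, hx⟩ := (nontrivial_iff_exists_ne (0 : h j)).1 (hh j).1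
          have : (x : V) ∈ (⊥ : Submodule A V) := htop ▸ Submodule.mem_top
          exact hx (Subtype.ext (by simpa using this))⟩
        refine ⟨fun i => (hι.false i).elim, by simp, by simp, ?_⟩
        have := subsingleton_of_bot_eq_top htop
        exact ⟨disjoint_iff.2 (Subsingleton.elim _ _), codisjoint_iff.2 (Subsingleton.elim _ _)⟩
      · have hκ : Nonempty κ := by
          by_contra hκ
          rw [not_nonempty_iff] at hκ
          have htop : (⊥ : Submodule A V) = ⊤ := by rw [← hhsup, iSup_of_empty]
          obtain ⟨x, hx⟩ := (nontrivial_iff_exists_ne (0 : g i)).1 (hg i).1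
          have : (x : V) ∈ (⊥ : Submodule A V) := htop ▸ Submodule.mem_top
          exact hx (Subtype.ext (by simpa using this))
        refine ⟨fun _ => hκ.some, by simp, by simp, ?_⟩
        simpa [hhsup] using isCompl_bot_top (α := Submodule A V)
    | insert i D hi ih =>
      obtain ⟨σ, hinj, hbij, hcompl⟩ := ih
      have hpD : ∀ x ∈ ⨆ k ∈ D, g k, p i x = 0 := by
        intro x hx
        have hle : (⨆ k ∈ D, g k) ≤ LinearMap.ker (p i) :=
          iSup₂_le fun k hk y hy => hpzero i k (ne_of_mem_of_not_mem hk hi) y hy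
        exact hle hx
      obtain ⟨j, hj, hjb, hjc⟩ := exists_bijOn_isCompl_exchange (hg i) hh hq
        (fun j k hk => le_iSup₂_of_le k hk le_rfl) hcompl (p i) (hp i) (hpid i) hpD
      have hupd : ∀ k ∈ D, Function.update σ i j k = σ k := fun k hk =>
        Function.update_of_ne (ne_of_mem_of_not_mem hk hi) _ _
      have himg : D.image (Function.update σ i j) = D.image σ := Finset.image_congr hupd
      have hjD : j ∉ D.image σ := Finset.mem_compl.1 hj
      refine ⟨Function.update σ i j, ?_, ?_, ?_⟩
      · rw [Finset.coe_insert, Set.injOn_insert (by simpa using hi)]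
        refine ⟨hinj.congr fun k hk => (hupd k hk).symm, ?_⟩
        rw [Function.update_self, ← Finset.coe_image, himg]
        simpa using hjD
      · intro k hk
        rcases Finset.mem_insert.1 hk with rfl | hk
        · rwa [Function.update_self]
        · rw [hupd k hk]
          exact hbij k hk
      · rw [Finset.iSup_insert, Finset.image_insert, Function.update_self, himg,
          Finset.compl_insert]
        exact hjc
  obtain ⟨σ, hinj, hbij, hcompl⟩ := main Finset.univ
  have hsurj : Function.Surjective σ := by
    intro j
    by_contra hj
    have hbot : (⨆ j ∈ (Finset.univ.image σ)ᶜ, h j) = ⊥ := by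
      refine eq_bot_of_top_isCompl ?_
      simpa [hgsup] using hcompl
    have hle : h j ≤ ⊥ := hbot ▸ le_iSup₂_of_le j (by simpa using hj) le_rfl
    obtain ⟨x, hx⟩ := (nontrivial_iff_exists_ne (0 : h j)).1 (hh j).1
    exact hx (Subtype.ext (by simpa using hle x.2))
  refine ⟨Equiv.ofBijective σ ⟨fun a b hab => hinj (by simp) (by simp) hab, hsurj⟩, fun i => ?_⟩
  exact hbij i (Finset.mem_univ i)

end KrullSchmidt

section LieIdealDecomposition

variable {K L : Type*} [Field K] [LieRing L] [LieAlgebra K L]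

/-- The associative algebra of endomorphisms of `L` generated by the inner derivations. -/
abbrev innerMultiplicationAlgebra (K L : Type*) [Field K] [LieRing L] [LieAlgebra K L] :
    Subalgebra K (Module.End K L) :=
  Algebra.adjoin K (Set.range fun x : L => (LieAlgebra.ad K L x : Module.End K L))

/-- The inner derivation `ad x` as an element of `innerMultiplicationAlgebra`. -/
def innerMultiplicationAlgebra.ad (K : Type*) {L : Type*} [Field K] [LieRing L] [LieAlgebra K L]
    (x : L) : innerMultiplicationAlgebra K L :=
  ⟨LieAlgebra.ad K L x, Algebra.subset_adjoin ⟨x, rfl⟩⟩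

/-- A Lie ideal as a submodule over `innerMultiplicationAlgebra`. -/
def LieIdeal.toInnerSubmodule (I : LieIdeal K L) :
    Submodule (innerMultiplicationAlgebra K L) L where
  carrier := I
  add_mem' := add_mem
  zero_mem' := zero_mem I
  smul_mem' := by
    rintro ⟨a, ha⟩ x hx
    change a x ∈ I
    induction ha using Algebra.adjoin_induction generalizing x with
    | mem _ h =>
      obtain ⟨y, rfl⟩ := h
      exact lie_mem_right K L I y x hx
    | algebraMap r => exact I.smul_mem r hx
    | add a b _ _ iha ihb => exact add_mem (iha hx) (ihb hx)
    | mul a b _ _ iha ihb => exact iha (ihb hx)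

/-- A submodule over `innerMultiplicationAlgebra` as a Lie ideal. -/
def LieIdeal.ofInnerSubmodule (I : Submodule (innerMultiplicationAlgebra K L) L) :
    LieIdeal K L where
  carrier := I
  add_mem' := add_mem
  zero_mem' := zero_mem I
  smul_mem' := fun r x hx => by
    simpa [Algebra.smul_def] using
      I.smul_mem (algebraMap K (innerMultiplicationAlgebra K L) r) hx
  lie_mem := fun {x _} hm => I.smul_mem (innerMultiplicationAlgebra.ad K x) hm

/-- Lie ideals of `L` correspond to submodules over `innerMultiplicationAlgebra`. -/
def LieIdeal.innerSubmoduleOrderIso :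
    LieIdeal K L ≃o Submodule (innerMultiplicationAlgebra K L) L where
  toFun := LieIdeal.toInnerSubmodule
  invFun := LieIdeal.ofInnerSubmodule
  left_inv _ := rfl
  right_inv _ := rfl
  map_rel_iff' := Iff.rfl

theorem LieDirectlyIndecomposable.moduleIndecomposable {I : LieIdeal K L}
    (hI : LieDirectlyIndecomposable K I) :
    ModuleIndecomposable (innerMultiplicationAlgebra K L) I.toInnerSubmodule := by
  refine ⟨hI.1, fun J₁ J₂ hJ => ?_⟩
  let F : Submodule (innerMultiplicationAlgebra K L) I.toInnerSubmodule → LieIdeal K I := fun J =>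
    { carrier := {x | (⟨x, x.2⟩ : I.toInnerSubmodule) ∈ J}
      add_mem' := fun ha hb => J.add_mem ha hb
      zero_mem' := J.zero_mem
      smul_mem' := fun r x hx => by
        have := J.smul_mem (algebraMap K (innerMultiplicationAlgebra K L) r) hx
        exact this
      lie_mem := fun {x _} hm => J.smul_mem (innerMultiplicationAlgebra.ad K (x : L)) hm }
  have hbot : ∀ J, F J = ⊥ → J = ⊥ := by
    intro J hJ
    rw [Submodule.eq_bot_iff]
    intro x hx
    have : (⟨x, x.2⟩ : I) ∈ F J := hx
    rw [hJ, LieSubmodule.mem_bot] at this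
    exact Subtype.ext (congrArg Subtype.val this)
  refine (hI.2 (F J₁) (F J₂) ?_ ?_).imp (hbot J₁) (hbot J₂)
  · rw [LieSubmodule.eq_bot_iff]
    rintro x ⟨h₁, h₂⟩
    have := Submodule.disjoint_def.1 hJ.disjoint _ h₁ h₂
    exact Subtype.ext (congrArg Subtype.val this)
  · rw [eq_top_iff]
    intro x _
    have hx : (⟨x, x.2⟩ : I.toInnerSubmodule) ∈ J₁ ⊔ J₂ := hJ.sup_eq_top ▸ Submodule.mem_top
    obtain ⟨y, hy, z, hz, hyz⟩ := Submodule.mem_sup.1 hx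
    refine (LieSubmodule.mem_sup _ _ _).2 ⟨⟨y, y.2⟩, hy, ⟨z, z.2⟩, hz, ?_⟩
    exact Subtype.ext (congrArg Subtype.val hyz)

/-- A linear map commuting with all inner derivations is linear over
`innerMultiplicationAlgebra`. -/
def LinearMap.toInnerLinear (p : L →ₗ[K] L) (hp : ∀ x y : L, p ⁅x, y⁆ = ⁅x, p y⁆) :
    L →ₗ[innerMultiplicationAlgebra K L] L where
  toFun := p
  map_add' := p.map_add
  map_smul' := by
    rintro ⟨a, ha⟩ x
    change p (a x) = a (p x)
    induction ha using Algebra.adjoin_induction generalizing x with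
    | mem _ h =>
      obtain ⟨y, rfl⟩ := h
      exact hp y x
    | algebraMap r => exact p.map_smul r x
    | add a b _ _ iha ihb => rw [LinearMap.add_apply, map_add, iha, ihb, LinearMap.add_apply]
    | mul a b _ _ iha ihb => rw [Module.End.mul_apply, iha, ihb, Module.End.mul_apply]

theorem lie_eq_zero_of_inf_eq_bot {I J : LieIdeal K L} (hIJ : I ⊓ J = ⊥) {x y : L}
    (hx : x ∈ I) (hy : y ∈ J) : ⁅x, y⁆ = 0 := by
  have : ⁅x, y⁆ ∈ I ⊓ J :=
    ⟨lie_mem_left K L I x y hx, lie_mem_right K L J x y hy⟩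
  rwa [hIJ, LieSubmodule.mem_bot] at this

/-- The projection onto a summand of a direct sum of Lie ideals commutes with inner
derivations. -/
theorem projection_lie {ι : Type*} {g : ι → LieIdeal K L} (hgsup : (⨆ i, g i) = ⊤) {i : ι}
    (p : L →ₗ[K] L) (hpid : ∀ x ∈ g i, p x = x)
    (hpzero : ∀ k, k ≠ i → ∀ x ∈ g k, p x = 0) (x y : L) : p ⁅x, y⁆ = ⁅x, p y⁆ := by
  have hy : y ∈ ⨆ i, g i := hgsup ▸ LieSubmodule.mem_top y
  induction hy using LieSubmodule.iSup_induction' with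
  | mem k y hy =>
    have hxy := lie_mem_right K L (g k) x y hy
    by_cases hk : k = i
    · subst hk
      rw [hpid _ hxy, hpid _ hy]
    · rw [hpzero k hk _ hxy, hpzero k hk _ hy, lie_zero]
  | zero => simp
  | add y z _ _ hy hz => rw [lie_add, map_add, hy, hz, map_add, lie_add]

/-- The difference of an element and its projection to a summand lies in the sum of the other
summands. -/
theorem sub_projection_mem_iSup_ne {ι : Type*} {g : ι → LieIdeal K L} (hgsup : (⨆ i, g i) = ⊤)
    {i : ι} (p : L →ₗ[K] L) (hpid : ∀ x ∈ g i, p x = x)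
    (hpzero : ∀ k, k ≠ i → ∀ x ∈ g k, p x = 0) (x : L) :
    x - p x ∈ (⨆ k, ⨆ _ : k ≠ i, g k : LieIdeal K L) := by
  have hx : x ∈ ⨆ i, g i := hgsup ▸ LieSubmodule.mem_top x
  induction hx using LieSubmodule.iSup_induction' with
  | mem k y hy =>
    by_cases hk : k = i
    · subst hk
      rw [hpid _ hy, sub_self]
      exact zero_mem _
    · rw [hpzero k hk _ hy, sub_zero]
      exact (le_iSup₂_of_le k hk le_rfl : g k ≤ ⨆ k, ⨆ _ : k ≠ i, g k) hy
  | zero => simp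
  | add y z _ _ hy hz =>
    rw [map_add, add_sub_add_comm]
    exact add_mem hy hz

end LieIdealDecomposition

/-- **Krull–Schmidt theorem for Lie algebras.** Given two direct sum
decompositions `L = g₁ ⊕ ⋯ ⊕ g_r = h₁ ⊕ ⋯ ⊕ h_s` into directly indecomposable Lie
ideals, with projections `π i` along the first decomposition, one has `r = s` and there
is a permutation `σ` such that for `j = σ i`: `π i` restricts to a Lie algebra isomorphism
`h j ≃ g i`, `[g i, g i] = [h j, h j]`, and `h j ⊆ g i ⊕ Z(⊕_{k ≠ i} g k)`. -/
theorem stmt5 {K L : Type*} [Field K] [LieRing L] [LieAlgebra K L]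
    [FiniteDimensional K L] {r s : ℕ}
    (g : Fin r → LieIdeal K L) (h : Fin s → LieIdeal K L)
    (hgsup : (⨆ i, g i) = ⊤)
    (hgdisj : ∀ i, g i ⊓ (⨆ k, ⨆ _ : k ≠ i, g k) = ⊥)
    (hhsup : (⨆ j, h j) = ⊤)
    (hhdisj : ∀ j, h j ⊓ (⨆ k, ⨆ _ : k ≠ j, h k) = ⊥)
    (hgind : ∀ i, LieDirectlyIndecomposable K (g i))
    (hhind : ∀ j, LieDirectlyIndecomposable K (h j))
    (π : Fin r → (L →ₗ[K] L))
    (hπmem : ∀ i x, π i x ∈ g i)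
    (hπid : ∀ i, ∀ x ∈ g i, π i x = x)
    (hπzero : ∀ i k, k ≠ i → ∀ x ∈ g k, π i x = 0) :
    r = s ∧ ∃ σ : Fin r ≃ Fin s, ∀ i : Fin r,
      IsLieIsoOn (π i) (h (σ i)) (g i) ∧
      ⁅g i, g i⁆ = ⁅h (σ i), h (σ i)⁆ ∧
      (∀ x ∈ h (σ i), ∃ a ∈ g i, ∃ z ∈ centerOfComplSup g i, x = a + z) := by
  have hlie : ∀ i (x y : L), π i ⁅x, y⁆ = ⁅x, π i y⁆ := fun i =>
    projection_lie hgsup (π i) (hπid i) (hπzero i)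
  have hker : ∀ i, ∀ y ∈ (⨆ k, ⨆ _ : k ≠ i, g k : LieIdeal K L), π i y = 0 := by
    intro i y hy
    have h1 := sub_projection_mem_iSup_ne hgsup (π i) (hπid i) (hπzero i) y
    have h2 : π i y ∈ (⨆ k, ⨆ _ : k ≠ i, g k : LieIdeal K L) := by
      simpa using sub_mem hy h1
    have h3 : π i y ∈ g i ⊓ (⨆ k, ⨆ _ : k ≠ i, g k) := ⟨hπmem i y, h2⟩
    rwa [hgdisj i, LieSubmodule.mem_bot] at h3
  let e := LieIdeal.innerSubmoduleOrderIso (K := K) (L := L)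
  have : IsNoetherian (innerMultiplicationAlgebra K L) L := isNoetherian_of_tower K inferInstance
  have : IsArtinian (innerMultiplicationAlgebra K L) L := isArtinian_of_tower K inferInstance
  obtain ⟨σ, hσ⟩ := exists_equiv_bijOn_projection (A := innerMultiplicationAlgebra K L)
    (g := fun i => e (g i)) (h := fun j => e (h j))
    (fun i => (hgind i).moduleIndecomposable) (fun j => (hhind j).moduleIndecomposable)
    (by rw [← e.map_iSup, hgsup, e.map_top])
    (iSupIndep.map_orderIso e fun j => disjoint_iff.2 (hhdisj j))
    (by rw [← e.map_iSup, hhsup, e.map_top])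
    (fun i => (π i).toInnerLinear (hlie i)) hπmem hπid hπzero
  replace hσ : ∀ i, Set.BijOn (π i) (h (σ i) : Set L) (g i : Set L) := hσ
  have hcomm : ∀ i, ∀ x ∈ h (σ i), ∀ y ∈ (⨆ k, ⨆ _ : k ≠ i, g k : LieIdeal K L),
      ⁅x, y⁆ = 0 := by
    intro i x hx y hy
    refine (hσ i).injOn (lie_mem_left K L _ x y hx) (zero_mem (h (σ i))) ?_
    rw [hlie, hker i y hy, lie_zero, map_zero]
  have hdecomp : ∀ i, ∀ x ∈ h (σ i), x - π i x ∈ centerOfComplSup g i := by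
    intro i x hx
    refine ⟨sub_projection_mem_iSup_ne hgsup (π i) (hπid i) (hπzero i) x, fun y hy => ?_⟩
    rw [sub_lie, hcomm i x hx y hy, lie_eq_zero_of_inf_eq_bot (hgdisj i) (hπmem i x) hy, sub_zero]
  have hbracket : ∀ i, ∀ x ∈ h (σ i), ∀ y ∈ h (σ i), ⁅π i x, π i y⁆ = ⁅x, y⁆ := by
    intro i x hx y hy
    have hy' := (hdecomp i y hy).1
    have h1 : ⁅x, y - π i y⁆ = 0 := hcomm i x hx _ hy'
    have h2 : ⁅x - π i x, π i y⁆ = 0 := by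
      rw [← lie_skew, lie_eq_zero_of_inf_eq_bot (hgdisj i) (hπmem i y) (hdecomp i x hx).1, neg_zero]
    rw [lie_sub, sub_eq_zero] at h1
    rw [sub_lie, sub_eq_zero] at h2
    rw [h1, h2]
  refine ⟨by simpa using Fintype.card_congr σ, σ, fun i => ⟨⟨?_, ?_, ?_, ?_⟩, ?_, ?_⟩⟩
  · exact fun x _ => hπmem i x
  · intro x hx y hy
    rw [hbracket i x hx y hy, ← hbracket i x hx y hy, hπid i _ (lie_mem_left K L _ _ _ (hπmem i x))]
  · exact (hσ i).injOn
  · exact fun y hy => (hσ i).surjOn hy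
  · apply le_antisymm
    · rw [LieSubmodule.lieIdeal_oper_eq_span, LieSubmodule.lieSpan_le]
      rintro _ ⟨⟨a, ha⟩, ⟨b, hb⟩, rfl⟩
      obtain ⟨x, hx, rfl⟩ := (hσ i).surjOn ha
      obtain ⟨y, hy, rfl⟩ := (hσ i).surjOn hb
      exact (hbracket i x hx y hy).symm ▸ LieSubmodule.lie_mem_lie hx hy
    · rw [LieSubmodule.lieIdeal_oper_eq_span, LieSubmodule.lieSpan_le]
      rintro _ ⟨⟨x, hx⟩, ⟨y, hy⟩, rfl⟩
      exact hbracket i x hx y hy ▸ LieSubmodule.lie_mem_lie (hπmem i x) (hπmem i y)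
  · exact fun x hx => ⟨π i x, hπmem i x, x - π i x, hdecomp i x hx, by abel⟩
end

section
/- Let L = L_1 ⊕ L_2 ⊕ … ⊕ L_r be a direct sum of finite-dimensional Lie algebras over a field K, each of which is directly indecomposable. (1) Every Lie algebra automorphism Φ of L can be written as Φ = Θ + Ψ (pointwise sum), where Θ is a Lie algebra automorphism of L mapping each summand L_i onto an isomorphic summand L_j, and Ψ is a central Lie algebra endomorphism of L, i.e. Ψ(L) ⊆ Z(L). (2) Conversely, if Θ is a Lie algebra automorphism of L mapping each summand L_i onto an isomorphic summand L_j and Ψ is a central Lie algebra endomorphism of L, and if the linear map Θ + Ψ is invertible, then Θ + Ψ is a Lie algebra automorphism of L. -/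
section

variable {K L M ι : Type*} [Field K] [LieRing L] [LieAlgebra K L] [LieRing M] [LieAlgebra K M]

/-- Fitting's lemma: an endomorphism of the adjoint module of a finite-dimensional directly
indecomposable Lie algebra is invertible or nilpotent. -/
theorem LieDirectlyIndecomposable.isUnit_or_isNilpotent [FiniteDimensional K M]
    (hM : LieDirectlyIndecomposable K M) (f : Module.End K M)
    (hf : ∀ x y : M, f ⁅x, y⁆ = ⁅x, f y⁆) : IsUnit f ∨ IsNilpotent f := by
  obtain ⟨n, hn, hpos⟩ := ((LinearMap.eventually_isCompl_ker_pow_range_pow f).and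
    (Filter.eventually_gt_atTop 0)).exists
  have hpow : ∀ m (x y : M), (f ^ m) ⁅x, y⁆ = ⁅x, (f ^ m) y⁆ := by
    intro m
    induction m with
    | zero => simp
    | succ m ih => intro x y; simp [pow_succ', ih, hf]
  let I : LieIdeal K M :=
    { LinearMap.ker (f ^ n) with
      lie_mem := fun {x y} hy => by
        have hy' : (f ^ n) y = 0 := hy
        change (f ^ n) ⁅x, y⁆ = 0
        rw [hpow, hy', lie_zero] }
  let J : LieIdeal K M :=
    { LinearMap.range (f ^ n) with
      lie_mem := fun {x y} hy => by
        obtain ⟨z, rfl⟩ := hy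
        exact ⟨⁅x, z⁆, hpow n x z⟩ }
  have hI : I.toSubmodule = LinearMap.ker (f ^ n) := rfl
  have hJ : J.toSubmodule = LinearMap.range (f ^ n) := rfl
  have hinf : I ⊓ J = ⊥ := by
    rw [← LieSubmodule.toSubmodule_inj, LieSubmodule.inf_toSubmodule, hI, hJ]
    exact hn.inf_eq_bot
  have hsup : I ⊔ J = ⊤ := by
    rw [← LieSubmodule.toSubmodule_inj, LieSubmodule.sup_toSubmodule, hI, hJ]
    exact hn.sup_eq_top
  rcases hM.2 I J hinf hsup with h | h
  · left
    rw [← LieSubmodule.toSubmodule_inj, hI] at h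
    exact (isUnit_pow_iff hpos.ne').1 ((LinearMap.isUnit_iff_ker_eq_bot _).2 h)
  · right
    rw [← LieSubmodule.toSubmodule_inj, hJ] at h
    exact ⟨n, LinearMap.range_eq_bot.1 h⟩

/-- If a finite sum of endomorphisms of the adjoint module of a directly indecomposable Lie
algebra is invertible, then one of the summands is. -/
theorem LieDirectlyIndecomposable.exists_isUnit_of_isUnit_sum [FiniteDimensional K M]
    (hM : LieDirectlyIndecomposable K M) (s : Finset ι) (f : ι → Module.End K M)
    (hf : ∀ i, ∀ x y : M, f i ⁅x, y⁆ = ⁅x, f i y⁆) (hs : IsUnit (∑ i ∈ s, f i)) :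
    ∃ i ∈ s, IsUnit (f i) := by
  classical
  induction s using Finset.induction_on with
  | empty =>
    have := hM.1
    simp at hs
  | insert a s ha ih =>
    obtain ⟨u, hu⟩ := hs
    have hu_comm : ∀ x y : M, (u : Module.End K M) ⁅x, y⁆ = ⁅x, (u : Module.End K M) y⁆ := by
      intro x y
      rw [hu]
      simp [hf, LinearMap.sum_apply, lie_sum]
    have huinv (z : M) : (↑u⁻¹ : Module.End K M) ((u : Module.End K M) z) = z := by
      rw [← Module.End.mul_apply, u.inv_mul, Module.End.one_apply]
    have huinv' (z : M) : (u : Module.End K M) ((↑u⁻¹ : Module.End K M) z) = z := by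
      rw [← Module.End.mul_apply, u.mul_inv, Module.End.one_apply]
    have hcomm : ∀ x y : M, (↑u⁻¹ * f a : Module.End K M) ⁅x, y⁆
        = ⁅x, (↑u⁻¹ * f a : Module.End K M) y⁆ := by
      intro x y
      rw [Module.End.mul_apply, Module.End.mul_apply, hf]
      conv_lhs => rw [← huinv' (f a y), ← hu_comm, huinv]
    rcases hM.isUnit_or_isNilpotent _ hcomm with h | h
    · exact ⟨a, Finset.mem_insert_self _ _, by simpa using h⟩
    · have h1 : (1 - ↑u⁻¹ * f a : Module.End K M) = ↑u⁻¹ * ∑ i ∈ s, f i := by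
        rw [← u.inv_mul, hu, Finset.sum_insert ha, mul_add, add_sub_cancel_left]
      have h2 := h.isUnit_one_sub
      rw [h1, Units.isUnit_units_mul] at h2
      obtain ⟨i, hi, hi'⟩ := ih h2
      exact ⟨i, Finset.mem_insert_of_mem hi, hi'⟩

/-- A linear map differing from an automorphism by a central map that vanishes on brackets is the
first component of a decomposition of the automorphism as a sum of two Lie algebra
endomorphisms, the second of which is central. -/
theorem LieEquiv.exists_add_central (Φ : L ≃ₗ⁅K⁆ L) (T : L →ₗ[K] L)
    (hcentral : ∀ x, Φ x - T x ∈ LieAlgebra.center K L) (hlie : ∀ x y : L, Φ ⁅x, y⁆ = T ⁅x, y⁆) :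
    ∃ Θ Ψ : L →ₗ⁅K⁆ L, (∀ x, Θ x = T x) ∧ (∀ x, Φ x = Θ x + Ψ x) ∧
      ∀ x, Ψ x ∈ LieAlgebra.center K L := by
  have hl (x y : L) : ⁅y, Φ x - T x⁆ = 0 :=
    (LieModule.mem_maxTrivSubmodule K L L _).1 (hcentral x) y
  have hr (x y : L) : ⁅Φ x - T x, y⁆ = 0 := by rw [← lie_skew, hl, neg_zero]
  have hT (x : L) : T x = Φ x - (Φ x - T x) := (sub_sub_cancel _ _).symm
  refine ⟨{ T with map_lie' := fun {x y} => ?_ },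
    { (Φ : L →ₗ[K] L) - T with map_lie' := fun {x y} => ?_ }, fun _ => rfl,
    fun x => (add_sub_cancel (T x) (Φ x)).symm, hcentral⟩
  · change T ⁅x, y⁆ = ⁅T x, T y⁆
    rw [hT x, hT y, sub_lie, lie_sub, hr, hl, sub_zero, sub_zero, ← hlie, LieEquiv.map_lie]
  · change Φ ⁅x, y⁆ - T ⁅x, y⁆ = ⁅Φ x - T x, Φ y - T y⁆
    rw [hl, hlie, sub_self]

/-- `p` is the family of projections onto the summands of the direct sum decomposition of `L`
into the ideals `g i`. -/
structure IsLieProjections [Fintype ι] (g : ι → LieIdeal K L) (p : ι → Module.End K L) :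
    Prop where
  mem : ∀ i x, p i x ∈ g i
  sum : ∀ x, ∑ i, p i x = x
  same : ∀ i, ∀ x ∈ g i, p i x = x
  ne : ∀ i j, i ≠ j → ∀ x ∈ g j, p i x = 0

theorem exists_isLieProjections [Fintype ι] (g : ι → LieIdeal K L)
    (hsup : (⨆ i, g i) = ⊤) (hind : iSupIndep g) : ∃ p, IsLieProjections g p := by
  classical
  have hint : DirectSum.IsInternal fun i => (g i).toSubmodule :=
    DirectSum.isInternal_submodule_of_iSupIndep_of_iSup_eq_top
      (LieSubmodule.iSupIndep_toSubmodule.2 hind) (LieSubmodule.iSup_toSubmodule_eq_top.2 hsup)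
  let := hint.chooseDecomposition
  refine ⟨fun i => (g i).toSubmodule.subtype ∘ₗ DirectSum.component K ι _ i ∘ₗ
    (DirectSum.decomposeLinearEquiv fun i => (g i).toSubmodule).toLinearMap, ?_, ?_, ?_, ?_⟩
  · intro i x
    exact Subtype.property _
  · intro x
    conv_rhs => rw [← (DirectSum.decompose fun i => (g i).toSubmodule).symm_apply_apply x,
      ← DirectSum.sum_univ_of (DirectSum.decompose (fun i => (g i).toSubmodule) x),
      DirectSum.decompose_symm_sum]
    simp only [DirectSum.decompose_symm_of]
    rfl
  · intro i x hx
    exact DirectSum.decompose_of_mem_same (fun i => (g i).toSubmodule) hx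
  · intro i j hij x hx
    exact DirectSum.decompose_of_mem_ne (fun i => (g i).toSubmodule) hx hij.symm

namespace IsLieProjections

variable [Fintype ι] {g : ι → LieIdeal K L} {p : ι → Module.End K L}

theorem map_lie (hp : IsLieProjections g p) (i : ι) (x y : L) : p i ⁅x, y⁆ = ⁅x, p i y⁆ := by
  classical
  conv_lhs => rw [← hp.sum y, lie_sum, map_sum]
  rw [Finset.sum_eq_single i]
  · exact hp.same i _ ((g i).lie_mem (hp.mem i y))
  · intro j _ hj
    exact hp.ne i j hj.symm _ ((g j).lie_mem (hp.mem j y))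
  · simp

variable [FiniteDimensional K L]

/-- An automorphism followed by a suitable projection is injective on an indecomposable summand,
and the image of that summand commutes with all the other summands. -/
theorem exists_injOn_and_lie_eq_zero (hp : IsLieProjections g p) (Φ : L ≃ₗ⁅K⁆ L) {i : ι}
    (hi : LieDirectlyIndecomposable K (g i)) :
    ∃ k, (∀ x ∈ g i, p k (Φ x) = 0 → x = 0) ∧
      ∀ j, j ≠ k → ∀ x ∈ g i, ∀ y ∈ g j, ⁅Φ x, y⁆ = 0 := by
  let P : L →ₗ[K] g i := (p i).codRestrict (g i).toSubmodule (hp.mem i)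
  let f : ι → Module.End K (g i) := fun k =>
    P ∘ₗ (Φ.symm : L →ₗ[K] L) ∘ₗ p k ∘ₗ (Φ : L →ₗ[K] L) ∘ₗ (g i).toSubmodule.subtype
  have hf_apply (k : ι) (x : g i) : (f k x : L) = p i (Φ.symm (p k (Φ x))) := rfl
  have hf (k : ι) (x y : g i) : f k ⁅x, y⁆ = ⁅x, f k y⁆ := by
    apply Subtype.ext
    change p i (Φ.symm (p k (Φ ⁅(x : L), (y : L)⁆))) = ⁅(x : L), p i (Φ.symm (p k (Φ y)))⁆
    rw [LieEquiv.map_lie, hp.map_lie, LieEquiv.map_lie, LieEquiv.symm_apply_apply, hp.map_lie]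
  have hsum : ∑ k, f k = 1 := by
    ext x
    simp [LinearMap.sum_apply, hf_apply, ← map_sum, hp.sum, hp.same i x x.2]
  obtain ⟨k, -, hk⟩ := hi.exists_isUnit_of_isUnit_sum Finset.univ f hf (hsum ▸ isUnit_one)
  have hinj : ∀ x ∈ g i, p k (Φ x) = 0 → x = 0 := by
    intro x hx h
    have h0 : f k ⟨x, hx⟩ = 0 := by
      apply Subtype.ext
      simp [hf_apply, h]
    have := (Module.End.isUnit_iff _).1 hk |>.1 (h0.trans (map_zero _).symm)
    exact congrArg Subtype.val this
  refine ⟨k, hinj, fun j hj x hx y hy => ?_⟩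
  have h1 : ⁅Φ x, y⁆ = Φ ⁅x, Φ.symm y⁆ := by rw [LieEquiv.map_lie, LieEquiv.apply_symm_apply]
  have h2 : p k ⁅Φ x, y⁆ = 0 := by rw [hp.map_lie, hp.ne k j hj.symm y hy, lie_zero]
  rw [h1] at h2 ⊢
  rw [hinj _ (lie_mem_left K L (g i) _ _ hx) h2, map_zero]

/-- The part of an automorphism that lives on the summand `g i` differs by a central map from an
injective map into a single summand `g k`. -/
theorem exists_summandMap (hp : IsLieProjections g p) (Φ : L ≃ₗ⁅K⁆ L) {i : ι}
    (hi : LieDirectlyIndecomposable K (g i)) :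
    ∃ (k : ι) (T : L →ₗ[K] L), (∀ x ∈ g i, T x ∈ g k) ∧ (∀ x ∈ g i, T x = 0 → x = 0) ∧
      (∀ x ∈ g i, Φ x - T x ∈ LieAlgebra.center K L) ∧
      (∀ x : L, ∀ y ∈ g i, Φ ⁅x, y⁆ = T ⁅x, y⁆) ∧
      (g i ≤ LieAlgebra.center K L ∧ k = i ∨ ∃ x ∈ g i, ∃ y ∈ g k, ⁅Φ x, y⁆ ≠ 0) := by
  classical
  by_cases hc : g i ≤ LieAlgebra.center K L
  · have hlie (x : L) {y : L} (hy : y ∈ g i) : ⁅x, y⁆ = 0 :=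
      (LieModule.mem_maxTrivSubmodule K L L y).1 (hc hy) x
    refine ⟨i, LinearMap.id, fun x hx => hx, fun x _ h => h, fun x hx => ?_, fun x y hy => ?_,
      .inl ⟨hc, rfl⟩⟩
    · rw [LieModule.mem_maxTrivSubmodule]
      intro y
      have h : ⁅y, Φ x⁆ = Φ ⁅Φ.symm y, x⁆ := by rw [LieEquiv.map_lie, LieEquiv.apply_symm_apply]
      rw [LinearMap.id_apply, lie_sub, hlie y hx, h, hlie _ hx, map_zero, sub_zero]
    · rw [hlie x hy, map_zero, map_zero]
  · obtain ⟨k, hinj, hzero⟩ := hp.exists_injOn_and_lie_eq_zero Φ hi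
    have hcentral : ∀ x ∈ g i, Φ x - p k (Φ x) ∈ LieAlgebra.center K L := by
      intro x hx
      have h : Φ x - p k (Φ x) = ∑ j ∈ Finset.univ.erase k, p j (Φ x) := by
        conv_lhs => enter [1]; rw [← hp.sum (Φ x)]
        rw [← Finset.add_sum_erase _ _ (Finset.mem_univ k), add_sub_cancel_left]
      rw [h]
      refine sum_mem fun j hj => (LieModule.mem_maxTrivSubmodule K L L _).2 fun y => ?_
      rw [← hp.map_lie, ← lie_skew, map_neg, hp.map_lie,
        hzero j (Finset.ne_of_mem_erase hj) x hx _ (hp.mem j y), neg_zero]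
    refine ⟨k, p k ∘ₗ (Φ : L →ₗ[K] L), fun x _ => hp.mem k _, hinj, hcentral,
      fun x y hy => ?_, .inr ?_⟩
    · have h := (LieModule.mem_maxTrivSubmodule K L L _).1 (hcentral y hy) (Φ x)
      rw [lie_sub, ← hp.map_lie, ← LieEquiv.map_lie] at h
      exact sub_eq_zero.1 h
    · by_contra! hcon
      refine hc fun x hx => (LieModule.mem_maxTrivSubmodule K L L x).2 fun y => ?_
      have h : ⁅Φ x, Φ y⁆ = 0 := by
        rw [← hp.sum (Φ y), lie_sum]
        refine Finset.sum_eq_zero fun j _ => ?_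
        by_cases hj : j = k
        · subst hj
          exact hcon x hx _ (hp.mem j _)
        · exact hzero j hj x hx _ (hp.mem j _)
      rw [← LieEquiv.map_lie] at h
      have h' : ⁅x, y⁆ = 0 := Φ.injective (h.trans (map_zero Φ).symm)
      rw [← lie_skew, h', neg_zero]

/-- Every automorphism of a direct sum of indecomposable Lie algebras is the sum of an
automorphism permuting the summands and a central endomorphism. -/
theorem exists_permuting_add_central (hp : IsLieProjections g p)
    (hind : ∀ i, LieDirectlyIndecomposable K (g i)) (Φ : L ≃ₗ⁅K⁆ L) :
    ∃ Θ Ψ : L →ₗ⁅K⁆ L, (∀ x, Φ x = Θ x + Ψ x) ∧ Function.Bijective Θ ∧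
      (∀ i, ∃ j, Submodule.map (Θ : L →ₗ[K] L) (g i).toSubmodule = (g j).toSubmodule) ∧
      ∀ x, Ψ x ∈ LieAlgebra.center K L := by
  classical
  choose σ T hmem hinj hcentral hlie hσ using fun i => hp.exists_summandMap Φ (hind i)
  choose τ _ hτ using fun k => hp.exists_injOn_and_lie_eq_zero Φ.symm (hind k)
  have hτσ {i k : ι} (h : ∃ x ∈ g i, ∃ y ∈ g k, ⁅Φ x, y⁆ ≠ 0) : i = τ k := by
    obtain ⟨x, hx, y, hy, hxy⟩ := h
    by_contra hne
    have h := congrArg Φ (hτ k i hne y hy x hx)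
    rw [LieEquiv.map_lie, LieEquiv.apply_symm_apply, map_zero] at h
    exact hxy (by rw [← lie_skew, h, neg_zero])
  have hcomm {i k : ι} (hk : g k ≤ LieAlgebra.center K L)
      (h : ∃ x ∈ g i, ∃ y ∈ g k, ⁅Φ x, y⁆ ≠ 0) : False := by
    obtain ⟨x, -, y, hy, hxy⟩ := h
    exact hxy ((LieModule.mem_maxTrivSubmodule K L L y).1 (hk hy) _)
  have hσ_inj : Function.Injective σ := by
    intro i j hij
    rcases hσ i with ⟨hi, hi'⟩ | hi <;> rcases hσ j with ⟨hj, hj'⟩ | hj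
    · rw [← hi', ← hj', hij]
    · rw [← hij, hi'] at hj
      exact (hcomm hi hj).elim
    · rw [hij, hj'] at hi
      exact (hcomm hj hi).elim
    · rw [hτσ hi, hτσ hj, hij]
  have hσ_surj : Function.Surjective σ := Finite.surjective_of_injective hσ_inj
  have hsumΦ (x : L) : Φ x = ∑ i, Φ (p i x) := by rw [← map_sum, hp.sum]
  obtain ⟨Θ, Ψ, hΘ, hsum, hΨ⟩ := Φ.exists_add_central (∑ i, T i ∘ₗ p i)
    (fun x => by
      rw [hsumΦ, LinearMap.sum_apply, ← Finset.sum_sub_distrib]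
      exact sum_mem fun i _ => hcentral i _ (hp.mem i x))
    (fun x y => by
      rw [hsumΦ, LinearMap.sum_apply]
      refine Finset.sum_congr rfl fun i _ => ?_
      rw [LinearMap.comp_apply, hp.map_lie]
      exact hlie i x _ (hp.mem i y))
  replace hΘ (x : L) : Θ x = ∑ i, T i (p i x) := by simp [hΘ, LinearMap.sum_apply]
  have hpΘ (i : ι) (x : L) : p (σ i) (Θ x) = T i (p i x) := by
    rw [hΘ, map_sum, Finset.sum_eq_single i]
    · exact hp.same _ _ (hmem i _ (hp.mem i x))
    · intro j _ hj
      exact hp.ne _ _ (hσ_inj.ne hj.symm) _ (hmem j _ (hp.mem j x))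
    · simp
  have hΘg (i : ι) (x : L) (hx : x ∈ g i) : Θ x = T i x := by
    rw [hΘ, Finset.sum_eq_single i]
    · rw [hp.same i x hx]
    · intro j _ hj
      rw [hp.ne j i hj x hx, map_zero]
    · simp
  have hΘ_inj : Function.Injective (Θ : L →ₗ[K] L) := by
    refine (injective_iff_map_eq_zero (Θ : L →ₗ[K] L)).2 fun x hx => ?_
    rw [← hp.sum x]
    refine Finset.sum_eq_zero fun i _ => hinj i _ (hp.mem i x) ?_
    rw [← hpΘ, show Θ x = 0 from hx, map_zero]
  have hΘ_surj : Function.Surjective (Θ : L →ₗ[K] L) := LinearMap.surjective_of_injective hΘ_inj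
  refine ⟨Θ, Ψ, hsum, ⟨hΘ_inj, hΘ_surj⟩, fun i => ⟨σ i, le_antisymm ?_ fun y hy => ?_⟩, hΨ⟩
  · rintro _ ⟨x, hx, rfl⟩
    change Θ x ∈ g (σ i)
    rw [hΘg i x hx]
    exact hmem i x hx
  · obtain ⟨x, rfl⟩ := hΘ_surj y
    refine ⟨p i x, hp.mem i x, ?_⟩
    change Θ (p i x) = Θ x
    rw [hΘg i _ (hp.mem i x), ← hpΘ]
    exact hp.same _ _ hy

end IsLieProjections

end

/-- Let `L = L₁ ⊕ ⋯ ⊕ L_r` be a direct sum of finite-dimensional directly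
indecomposable Lie algebras (realized internally as a direct sum of Lie ideals `g i`).
(1) Every Lie algebra automorphism `Φ` of `L` can be written as `Φ = Θ + Ψ` with `Θ` a Lie
algebra automorphism mapping each summand onto an isomorphic summand and `Ψ` a central Lie
algebra endomorphism.  (2) Conversely, given such `Θ` and `Ψ`, if the linear map `Θ + Ψ` is
invertible then it is a Lie algebra automorphism of `L`. -/
theorem stmt8 {K L : Type*} [Field K] [LieRing L] [LieAlgebra K L]
    [FiniteDimensional K L] {r : ℕ}
    (g : Fin r → LieIdeal K L)
    (hsup : (⨆ i, g i) = ⊤)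
    (hdisj : ∀ i, g i ⊓ (⨆ k, ⨆ _ : k ≠ i, g k) = ⊥)
    (hind : ∀ i, LieDirectlyIndecomposable K (g i)) :
    (∀ Φ : L →ₗ⁅K⁆ L, Function.Bijective Φ →
      ∃ Θ Ψ : L →ₗ⁅K⁆ L,
        (∀ x : L, Φ x = Θ x + Ψ x) ∧
        Function.Bijective Θ ∧
        (∀ i, ∃ j, Submodule.map (Θ : L →ₗ[K] L) (g i : Submodule K L)
          = (g j : Submodule K L)) ∧
        (∀ x : L, Ψ x ∈ LieAlgebra.center K L)) ∧
    (∀ Θ Ψ : L →ₗ⁅K⁆ L,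
      Function.Bijective Θ →
      (∀ i, ∃ j, Submodule.map (Θ : L →ₗ[K] L) (g i : Submodule K L)
        = (g j : Submodule K L)) →
      (∀ x : L, Ψ x ∈ LieAlgebra.center K L) →
      Function.Bijective ((Θ : L →ₗ[K] L) + (Ψ : L →ₗ[K] L)) →
      ∃ e : L ≃ₗ⁅K⁆ L, ∀ x : L, e x = Θ x + Ψ x) := by
  refine ⟨fun Φ hΦ => ?_, fun Θ Ψ _ _ hΨ hbij => ?_⟩
  · obtain ⟨p, hp⟩ := exists_isLieProjections g hsup fun i => disjoint_iff.2 (hdisj i)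
    exact hp.exists_permuting_add_central hind (LieEquiv.ofBijective Φ hΦ)
  · have hl (x y : L) : ⁅y, Ψ x⁆ = 0 := (LieModule.mem_maxTrivSubmodule K L L _).1 (hΨ x) y
    have hr (x y : L) : ⁅Ψ x, y⁆ = 0 := by rw [← lie_skew, hl, neg_zero]
    let F : L →ₗ⁅K⁆ L :=
      { (Θ : L →ₗ[K] L) + (Ψ : L →ₗ[K] L) with
        map_lie' := fun {x y} => by
          change Θ ⁅x, y⁆ + Ψ ⁅x, y⁆ = ⁅Θ x + Ψ x, Θ y + Ψ y⁆
          simp only [LieHom.map_lie, add_lie, lie_add, hl, hr, add_zero] }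
    exact ⟨LieEquiv.ofBijective F hbij, fun _ => rfl⟩
end

section
/- Let G be a group such that its center Z(G) is torsion-free and the quotient G/Z(G) is finitely generated and residually finite. Suppose φ, θ, ζ : G → G are group endomorphisms such that φ(x) = θ(x)·ζ(x) for all x ∈ G, θ(Z(G)) ⊆ Z(G), ζ(G) ⊆ Z(G), and ζ restricted to Z(G) is the trivial homomorphism. Then the Reidemeister numbers of φ and θ are equal: R(φ) = R(θ). -/
/-- The `φ`-twisted conjugacy relation: `x` and `y` are `φ`-twisted conjugate if
`x = z * y * (φ z)⁻¹` for some `z`. -/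
def twistedConj {G : Type*} [Group G] (φ : G →* G) (x y : G) : Prop :=
  ∃ z : G, x = z * y * (φ z)⁻¹

/-- The Reidemeister number `R(φ) ∈ ℕ_{>0} ∪ {∞}` of an endomorphism `φ`: the number of
`φ`-twisted conjugacy classes, with value `⊤` when there are infinitely many. -/
noncomputable def reidemeisterNumber {G : Type*} [Group G] (φ : G →* G) : ℕ∞ :=
  @ite _ (Finite (Quot (twistedConj φ))) (Classical.propDecidable _)
    ((Nat.card (Quot (twistedConj φ)) : ℕ∞)) ⊤

/-- A group is residually finite if every nontrivial element avoids some finite-index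
normal subgroup. -/
def IsResiduallyFinite (G : Type*) [Group G] : Prop :=
  ∀ g : G, g ≠ 1 → ∃ N : Subgroup G, N.Normal ∧ N.FiniteIndex ∧ g ∉ N

/-- A multiset of at most `r` unit fractions with a given sum has bounded denominators. -/
theorem exists_bound_of_sum_inv_eq (r : ℕ) (c : ℚ) :
    ∃ B : ℕ, ∀ m : Multiset ℕ, m.card ≤ r → (∀ n ∈ m, 0 < n) →
      (m.map fun n : ℕ => (n : ℚ)⁻¹).sum = c → ∀ n ∈ m, n ≤ B := by
  induction r generalizing c with
  | zero =>
    refine ⟨0, fun m hm _ _ n hn => ?_⟩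
    rw [Multiset.card_eq_zero.1 (Nat.le_zero.1 hm)] at hn
    simp at hn
  | succ r ih =>
    choose B hB using ih
    let N := ⌈((r + 1 : ℕ) : ℚ) / c⌉₊
    refine ⟨max N ((Finset.range (N + 1)).sup fun k => B (c - (k : ℚ)⁻¹)), ?_⟩
    intro m hm hpos hsum n hn
    have hnonneg : ∀ x ∈ m.map fun n : ℕ => (n : ℚ)⁻¹, 0 ≤ x := by
      simp only [Multiset.mem_map]
      rintro _ ⟨k, -, rfl⟩
      positivity
    have hc : 0 < c := by
      rw [← hsum]
      exact (inv_pos.2 (Nat.cast_pos.2 (hpos n hn))).trans_le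
        (Multiset.single_le_sum hnonneg _ (Multiset.mem_map_of_mem (fun n : ℕ => (n : ℚ)⁻¹) hn))
    obtain ⟨k, hk, hkN⟩ : ∃ k ∈ m, k ≤ N := by
      by_contra! h
      have hlt : (m.map fun n : ℕ => (n : ℚ)⁻¹).sum < (m.map fun _ : ℕ => c / ((r + 1 : ℕ) : ℚ)).sum := by
        refine Multiset.sum_lt_sum_of_nonempty (by rintro rfl; simp at hn) fun k hk => ?_
        rw [← inv_div]
        exact inv_strictAnti₀ (by positivity) (Nat.lt_of_ceil_lt (h k hk))
      rw [hsum, Multiset.map_const', Multiset.sum_replicate, nsmul_eq_mul] at hlt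
      have hmr : (m.card : ℚ) ≤ ((r + 1 : ℕ) : ℚ) := by exact_mod_cast hm
      have : (m.card : ℚ) * (c / ((r + 1 : ℕ) : ℚ)) ≤ ((r + 1 : ℕ) : ℚ) * (c / ((r + 1 : ℕ) : ℚ)) :=
        mul_le_mul_of_nonneg_right hmr (by positivity)
      rw [mul_div_cancel₀ c (by positivity)] at this
      linarith
    obtain ⟨m, rfl⟩ := Multiset.exists_cons_of_mem hk
    rw [Multiset.mem_cons] at hn
    rcases hn with rfl | hn
    · exact le_max_of_le_left hkN
    · refine le_max_of_le_right ((hB (c - (k : ℚ)⁻¹) m (by simpa using hm)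
        (fun a ha => hpos a (Multiset.mem_cons_of_mem ha)) ?_ n hn).trans
        (Finset.le_sup (f := fun k : ℕ => B (c - (k : ℚ)⁻¹)) (Finset.mem_range_succ_iff.2 hkN)))
      rw [Multiset.map_cons, Multiset.sum_cons] at hsum
      linarith

/-- If a finite group acts on a set of its own size, the order of the point stabilizers is bounded
in terms of the number of orbits. -/
theorem exists_bound_card_stabilizer (r : ℕ) :
    ∃ B : ℕ, ∀ (K X : Type*) [Group K] [MulAction K X] [Finite K] [Finite X],
      Nat.card X = Nat.card K → Nat.card (MulAction.orbitRel.Quotient K X) ≤ r →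
      ∀ x : X, Nat.card (MulAction.stabilizer K x) ≤ B := by
  obtain ⟨B, hB⟩ := exists_bound_of_sum_inv_eq r 1
  refine ⟨B, fun K X _ _ _ _ hcard hr x => ?_⟩
  classical
  have := Fintype.ofFinite K
  have := Fintype.ofFinite X
  have := Fintype.ofFinite (MulAction.orbitRel.Quotient K X)
  let f : MulAction.orbitRel.Quotient K X → ℕ := fun ω => Nat.card (MulAction.stabilizer K ω.out)
  have hx : Nat.card (MulAction.stabilizer K x) =
      f (Quotient.mk (MulAction.orbitRel K X) x) :=
    Nat.card_congr (MulAction.stabilizerEquivStabilizerOfOrbitRel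
      ((MulAction.orbitRel K X).symm (Quotient.mk_out (s := MulAction.orbitRel K X) x))).toEquiv
  rw [hx]
  refine hB (Finset.univ.val.map f) ?_ ?_ ?_ _ (Multiset.mem_map_of_mem f (Finset.mem_univ _))
  · simpa [Nat.card_eq_fintype_card] using hr
  · intro n hn
    obtain ⟨ω, -, rfl⟩ := Multiset.mem_map.1 hn
    exact Nat.card_pos
  · have hsum := MulAction.card_eq_sum_card_group_div_card_stabilizer K X
    rw [← Nat.card_eq_fintype_card, hcard, ← Nat.card_eq_fintype_card] at hsum
    have hK : (Nat.card K : ℚ) ≠ 0 := Nat.cast_ne_zero.2 Nat.card_pos.ne'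
    rw [Multiset.map_map]
    change ∑ ω, ((f ω : ℕ) : ℚ)⁻¹ = 1
    apply mul_left_cancel₀ hK
    rw [mul_one, Finset.mul_sum]
    conv_rhs => rw [hsum]
    rw [Nat.cast_sum]
    refine Finset.sum_congr rfl fun ω _ => ?_
    rw [← Nat.card_eq_fintype_card, Nat.cast_div (Subgroup.card_subgroup_dvd_card _)
      (Nat.cast_ne_zero.2 Nat.card_pos.ne'), div_eq_mul_inv]

/-- The group `G`, seen as a set on which `G` acts by `ψ`-twisted conjugation. -/
def TwistedSpace {G : Type*} [Group G] (_ψ : G →* G) : Type _ := G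

instance TwistedSpace.instMulAction {G : Type*} [Group G] (ψ : G →* G) :
    MulAction G (TwistedSpace ψ) where
  smul g x := (g * id (α := G) x * (ψ g)⁻¹ : G)
  one_smul x := show (1 * id (α := G) x * (ψ 1)⁻¹ : G) = id (α := G) x by
    rw [map_one, inv_one, mul_one, one_mul]
  mul_smul g h x := show (g * h * id (α := G) x * (ψ (g * h))⁻¹ : G) =
      g * (h * id (α := G) x * (ψ h)⁻¹) * (ψ g)⁻¹ by
    rw [map_mul, mul_inv_rev]
    simp only [mul_assoc]

theorem finite_monoidHom_of_fg (G H : Type*) [Group G] [Group H] [Finite H] (hG : Group.FG G) :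
    Finite (G →* H) := by
  obtain ⟨S, hS⟩ := Group.fg_def.1 hG
  refine Finite.of_injective (fun (f : G →* H) (s : S) => f s) fun f g hfg => ?_
  refine MonoidHom.eq_of_eqOn_top ?_
  rw [← hS]
  exact MonoidHom.eqOn_closure fun s hs => congrFun hfg ⟨s, hs⟩

/-- In a finitely generated group, every normal subgroup of finite index contains a normal
subgroup of finite index which is invariant under all endomorphisms. -/
theorem exists_fullyInvariant_le {G : Type*} [Group G] (hG : Group.FG G) (N : Subgroup G)
    (hN : N.Normal) (hfin : N.FiniteIndex) :
    ∃ M : Subgroup G, M.Normal ∧ M.FiniteIndex ∧ M ≤ N ∧ ∀ ψ : G →* G, M ≤ M.comap ψ := by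
  have := finite_monoidHom_of_fg G (G ⧸ N) hG
  refine ⟨⨅ f : G →* G ⧸ N, f.ker, Subgroup.normal_iInf_normal fun f => f.normal_ker,
    Subgroup.finiteIndex_iInf fun f => inferInstance, ?_, fun ψ x hx => ?_⟩
  · exact (iInf_le _ (QuotientGroup.mk' N)).trans (QuotientGroup.ker_mk' N).le
  · simp only [Subgroup.mem_comap, Subgroup.mem_iInf] at hx ⊢
    exact fun f => hx (f.comp ψ)

/-- A finite subset of a residually finite group injects into some finite quotient. -/
theorem IsResiduallyFinite.exists_injOn {G : Type*} [Group G] (hG : IsResiduallyFinite G)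
    (T : Set G) (hT : T.Finite) :
    ∃ N : Subgroup G, N.Normal ∧ N.FiniteIndex ∧
      ∀ a ∈ T, ∀ b ∈ T, a⁻¹ * b ∈ N → a = b := by
  have := hT.to_subtype
  choose N hN hfin hmem using hG
  let I := {p : T × T // (p.1 : G)⁻¹ * p.2 ≠ 1}
  refine ⟨⨅ p : I, N _ p.2, Subgroup.normal_iInf_normal fun p => hN _ _,
    Subgroup.finiteIndex_iInf fun p => hfin _ _, fun a ha b hb hab => ?_⟩
  by_contra hne
  have h : a⁻¹ * b ≠ 1 := fun h => hne (inv_mul_eq_one.1 h)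
  exact hmem _ h ((Subgroup.mem_iInf.1 hab) ⟨(⟨a, ha⟩, ⟨b, hb⟩), h⟩)

/-- If an endomorphism of a finitely generated residually finite group has finite Reidemeister
number, then the stabilizers of the twisted conjugation action are finite. -/
theorem finite_stabilizer_of_finite_quot {G : Type*} [Group G] (hfg : Group.FG G)
    (hrf : IsResiduallyFinite G) (ψ : G →* G) [Finite (Quot (twistedConj ψ))]
    (x : TwistedSpace ψ) : Finite (MulAction.stabilizer G x) := by
  obtain ⟨B, hB⟩ := exists_bound_card_stabilizer (Nat.card (Quot (twistedConj ψ)))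
  by_contra hinf
  have hinf' : (MulAction.stabilizer G x : Set G).Infinite :=
    Set.infinite_coe_iff.1 (not_finite_iff_infinite.1 hinf)
  obtain ⟨T, hTs, hTcard⟩ := hinf'.exists_subset_card_eq (B + 1)
  obtain ⟨N, hN, hNfin, hNT⟩ := hrf.exists_injOn (T : Set G) T.finite_toSet
  obtain ⟨M, hM, hMfin, hMN, hMinv⟩ := exists_fullyInvariant_le hfg N hN hNfin
  let ψM : G ⧸ M →* G ⧸ M := QuotientGroup.map M M ψ (hMinv ψ)
  let xM : TwistedSpace ψM := (QuotientGroup.mk (show G from x) : G ⧸ M)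
  have : Finite (TwistedSpace ψM) := inferInstanceAs (Finite (G ⧸ M))
  let π : Quot (twistedConj ψ) → MulAction.orbitRel.Quotient (G ⧸ M) (TwistedSpace ψM) :=
    Quot.lift (fun y => Quotient.mk (MulAction.orbitRel (G ⧸ M) (TwistedSpace ψM))
      (QuotientGroup.mk y : G ⧸ M)) (by
        rintro _ b ⟨z, rfl⟩
        exact Quotient.sound ⟨(z : G ⧸ M), rfl⟩)
  have hπ : Function.Surjective π := by
    intro ω
    induction ω using Quotient.inductionOn with
    | h y =>
      obtain ⟨y, rfl⟩ := QuotientGroup.mk_surjective (show G ⧸ M from y)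
      exact ⟨Quot.mk _ y, rfl⟩
  have hle := hB (G ⧸ M) (TwistedSpace ψM) rfl (Nat.card_le_card_of_surjective π hπ) xM
  let f : T → MulAction.stabilizer (G ⧸ M) xM := fun t => ⟨((t : G) : G ⧸ M), by
    have ht : (t : G) * (show G from x) * (ψ t)⁻¹ = (show G from x) := hTs t.2
    exact congrArg (QuotientGroup.mk : G → G ⧸ M) ht⟩
  have hf : Function.Injective f := fun s t hst =>
    Subtype.ext (hNT _ s.2 _ t.2 (hMN (QuotientGroup.eq.1 (congrArg Subtype.val hst))))
  have hcard := Nat.card_le_card_of_injective f hf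
  rw [Nat.card_eq_fintype_card, Fintype.card_coe, hTcard] at hcard
  omega

/-- A homomorphism that vanishes on all point stabilizers of an action can be extended to an
equivariant map on the set acted upon. -/
theorem exists_equivariant_of_stabilizer_le_ker {K X A : Type*} [Group K] [MulAction K X] [Group A]
    (f : K →* A) (hf : ∀ x : X, MulAction.stabilizer K x ≤ f.ker) :
    ∃ u : X → A, ∀ (k : K) (x : X), u (k • x) = f k * u x := by
  have hex : ∀ x : X, ∃ k : K, k • (Quotient.mk (MulAction.orbitRel K X) x).out = x := fun x =>
    (MulAction.orbitRel K X).symm (Quotient.mk_out (s := MulAction.orbitRel K X) x)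
  choose h hh using hex
  refine ⟨fun x => f (h x), fun k x => ?_⟩
  have hq : Quotient.mk (MulAction.orbitRel K X) (k • x) = Quotient.mk _ x :=
    Quotient.sound ⟨k, rfl⟩
  have hkx := hh (k • x)
  rw [hq] at hkx
  have hmem : (k * h x)⁻¹ * h (k • x) ∈
      MulAction.stabilizer K (Quotient.mk (MulAction.orbitRel K X) x).out := by
    rw [MulAction.mem_stabilizer_iff, mul_smul, hkx, inv_smul_eq_iff, mul_smul, hh]
  have := MonoidHom.mem_ker.1 (hf _ hmem)
  rw [map_mul, map_inv, inv_mul_eq_one, map_mul] at this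
  exact this.symm

theorem reidemeisterNumber_eq_of_equiv {G : Type*} [Group G] {φ θ : G →* G}
    (e : Quot (twistedConj φ) ≃ Quot (twistedConj θ)) :
    reidemeisterNumber φ = reidemeisterNumber θ := by
  unfold reidemeisterNumber
  rw [Nat.card_congr e]
  by_cases h : Finite (Quot (twistedConj φ))
  · rw [if_pos h, if_pos (e.finite_iff.1 h)]
  · rw [if_neg h, if_neg (e.finite_iff.not.1 h)]

/-- The Reidemeister number is infinite as soon as that of an induced endomorphism of a quotient
is. -/
theorem reidemeisterNumber_eq_top_of_quotient {G : Type*} [Group G] {N : Subgroup G} [N.Normal]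
    {φ : G →* G} {ψ : G ⧸ N →* G ⧸ N} (hψ : ∀ x : G, ψ x = φ x)
    (hinf : ¬ Finite (Quot (twistedConj ψ))) : reidemeisterNumber φ = ⊤ := by
  refine if_neg fun (hfin : Finite (Quot (twistedConj φ))) => hinf ?_
  refine Finite.of_surjective (Quot.map (ra := twistedConj φ) (rb := twistedConj ψ)
    (QuotientGroup.mk : G → G ⧸ N) ?_) ?_
  · rintro _ y ⟨z, rfl⟩
    exact ⟨z, by rw [hψ]; rfl⟩
  · rintro ⟨y⟩
    obtain ⟨y, rfl⟩ := QuotientGroup.mk_surjective y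
    exact ⟨Quot.mk _ y, rfl⟩

/-- Let `G` be a group with torsion-free center such that `G / Z(G)` is
finitely generated and residually finite.  If `φ = θ · ζ` pointwise, where
`θ(Z(G)) ⊆ Z(G)`, `ζ(G) ⊆ Z(G)` and `ζ` is trivial on `Z(G)`, then `R(φ) = R(θ)`. -/
theorem stmt13 {G : Type*} [Group G]
    (htf : ∀ x ∈ Subgroup.center G, IsOfFinOrder x → x = 1)
    (hfg : Group.FG (G ⧸ Subgroup.center G))
    (hrf : IsResiduallyFinite (G ⧸ Subgroup.center G))
    (φ θ ζ : G →* G)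
    (hsum : ∀ x : G, φ x = θ x * ζ x)
    (hθ : ∀ x ∈ Subgroup.center G, θ x ∈ Subgroup.center G)
    (hζ : ∀ x : G, ζ x ∈ Subgroup.center G)
    (hζZ : ∀ x ∈ Subgroup.center G, ζ x = 1) :
    reidemeisterNumber φ = reidemeisterNumber θ := by
  have hφZ : Subgroup.center G ≤ (Subgroup.center G).comap φ := fun x hx => by
    rw [Subgroup.mem_comap, hsum]
    exact mul_mem (hθ x hx) (hζ x)
  let ψ : G ⧸ Subgroup.center G →* G ⧸ Subgroup.center G := QuotientGroup.map _ _ φ hφZ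
  have hψφ : ∀ x : G, ψ x = φ x := fun x => rfl
  have hψθ : ∀ x : G, ψ x = θ x := fun x => by
    rw [hψφ, hsum]
    exact QuotientGroup.mk_mul_of_mem _ (hζ x)
  by_cases hfin : Finite (Quot (twistedConj ψ))
  swap
  · rw [reidemeisterNumber_eq_top_of_quotient hψφ hfin,
      reidemeisterNumber_eq_top_of_quotient hψθ hfin]
  let ζQ : G ⧸ Subgroup.center G →* Subgroup.center G :=
    QuotientGroup.lift _ (ζ.codRestrict _ hζ) fun x hx => Subtype.ext (hζZ x hx)
  have hζQ : ∀ x : G, (ζQ x : G) = ζ x := fun x => rfl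
  have hker : ∀ x : TwistedSpace ψ,
      MulAction.stabilizer (G ⧸ Subgroup.center G) x ≤ ζQ.ker := by
    intro x h hh
    have := finite_stabilizer_of_finite_quot hfg hrf ψ x
    have hord : IsOfFinOrder h :=
      Submonoid.isOfFinOrder_coe.2 (isOfFinOrder_of_finite (⟨h, hh⟩ : MulAction.stabilizer _ x))
    exact Subtype.ext (htf _ (ζQ h).2 (Submonoid.isOfFinOrder_coe.2 (ζQ.isOfFinOrder hord)))
  obtain ⟨u, hu⟩ := exists_equivariant_of_stabilizer_le_ker ζQ hker
  let v : G → Subgroup.center G := fun x => u (QuotientGroup.mk x : G ⧸ Subgroup.center G)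
  have hvZ : ∀ x, ∀ z ∈ Subgroup.center G, v (x * z) = v x := fun x z hz =>
    congrArg u (QuotientGroup.mk_mul_of_mem x hz)
  have hvφ : ∀ z y : G, (v (z * y * (φ z)⁻¹) : G) = ζ z * v y := fun z y =>
    congrArg Subtype.val (hu (z : G ⧸ Subgroup.center G) (y : G ⧸ Subgroup.center G))
  have hcomm : ∀ z ∈ Subgroup.center G, ∀ g : G, g * z = z * g :=
    fun z hz => Subgroup.mem_center_iff.1 hz
  let e : G ≃ G :=
    { toFun := fun x => x * v x
      invFun := fun x => x * (v x)⁻¹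
      left_inv := fun x => by simp [hvZ x _ (v x).2]
      right_inv := fun x => by simp [hvZ x _ (inv_mem (v x).2)] }
  have key : ∀ z y : G, e (z * y * (φ z)⁻¹) = z * e y * (θ z)⁻¹ := by
    intro z y
    change z * y * (φ z)⁻¹ * v (z * y * (φ z)⁻¹) = z * (y * v y) * (θ z)⁻¹
    rw [hvφ, hsum, mul_inv_rev]
    have h1 := hcomm _ (v y).2 (θ z)⁻¹
    have h2 := hcomm _ (hζ z) (θ z)⁻¹
    calc z * y * ((ζ z)⁻¹ * (θ z)⁻¹) * (ζ z * v y)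
        = z * y * (ζ z)⁻¹ * ((θ z)⁻¹ * ζ z) * v y := by group
      _ = z * y * ((θ z)⁻¹ * v y) := by rw [h2]; group
      _ = z * (y * v y) * (θ z)⁻¹ := by rw [h1]; group
  refine reidemeisterNumber_eq_of_equiv (Quot.congr e fun x y => ?_)
  constructor
  · rintro ⟨z, rfl⟩
    exact ⟨z, key z y⟩
  · rintro ⟨z, hz⟩
    exact ⟨z, e.injective (hz.trans (key z y).symm)⟩
end
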